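/- Let c be a real number with 1 < c < 4109054/1999527 and c ≠ 2, let ε > 0 be fixed and sufficiently small, let P be sufficiently large, τ = P^{1-c-ε}, and let X satisfy P^{9449/10000} ≪ X ≪ P. Then for every α ∈ (τ, 1-τ), the sum U*(α) = Σ_{X < n ≤ 2X} Λ(n)·e([n^c]·α) satisfies U*(α) ≪ X^{2627349/2666036 + ε}, where Λ is the von Mangoldt function. -/

import Mathlib

open scoped Classical
open Finset Real ArithmeticFunction

/-- `eC x = e(x) = e^{2πix}`. -/
noncomputable def eC (x : ℝ) : ℂ := Complex.exp ((2 * Real.pi * x : ℝ) * Complex.I)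

/-! ### The additive character -/

lemma norm_eC (x : ℝ) : ‖eC x‖ = 1 := Complex.norm_exp_ofReal_mul_I _

lemma eC_add (x y : ℝ) : eC (x + y) = eC x * eC y := by
  rw [eC, eC, eC, ← Complex.exp_add]
  congr 1
  push_cast
  ring

lemma eC_zero : eC 0 = 1 := by simp [eC]

lemma conj_eC (x : ℝ) : (starRingEnd ℂ) (eC x) = eC (-x) := by
  rw [eC, eC, ← Complex.exp_conj, map_mul, Complex.conj_ofReal, Complex.conj_I]
  congr 1
  push_cast
  ring

lemma eC_sub (x y : ℝ) : eC (x - y) = eC x * (starRingEnd ℂ) (eC y) := by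
  rw [sub_eq_add_neg, eC_add, conj_eC]

lemma eC_intCast (n : ℤ) : eC n = 1 := by
  rw [eC, Complex.exp_eq_one_iff]
  exact ⟨n, by push_cast; ring⟩

lemma eC_add_intCast (x : ℝ) (n : ℤ) : eC (x + n) = eC x := by
  rw [eC_add, eC_intCast, mul_one]

lemma eC_sub_intCast (x : ℝ) (n : ℤ) : eC (x - n) = eC x := by
  have := eC_add_intCast x (-n)
  simpa [sub_eq_add_neg] using this

lemma eC_nsmul (j : ℕ) (x : ℝ) : eC (j * x) = eC x ^ j := by
  rw [eC, eC, ← Complex.exp_nat_mul]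
  congr 1
  push_cast
  ring

lemma norm_one_sub_eC (x : ℝ) : ‖1 - eC x‖ = 2 * |sin (π * x)| := by
  have h := Complex.norm_exp_I_mul_ofReal_sub_one (2 * π * x)
  rw [norm_sub_rev, eC, mul_comm, h, norm_mul]
  simp only [Real.norm_eq_abs, Nat.abs_ofNat]
  congr 3
  ring

lemma norm_eC_sub_eC (x y : ℝ) : ‖eC x - eC y‖ = 2 * |sin (π * (y - x))| := by
  rw [← norm_one_sub_eC, eC_sub, ← mul_one ‖1 - _‖, ← norm_eC x, ← norm_mul,
    sub_mul, one_mul, mul_assoc, mul_comm _ (eC x), Complex.mul_conj, Complex.normSq_eq_norm_sq,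
    norm_eC]
  simp

lemma norm_eC_sub_eC_le (x y : ℝ) : ‖eC x - eC y‖ ≤ 2 * π * |x - y| := by
  rw [norm_eC_sub_eC]
  have := abs_sin_le_abs (x := π * (y - x))
  rw [abs_mul, abs_of_pos pi_pos, abs_sub_comm y x] at this
  linarith

lemma two_mul_le_sin_pi_mul {δ t : ℝ} (hδ : 0 ≤ δ) (h1 : δ ≤ t) (h2 : t ≤ 1 - δ) :
    2 * δ ≤ sin (π * t) := by
  have key : ∀ s : ℝ, δ ≤ s → s ≤ 1 / 2 → 2 * δ ≤ sin (π * s) := by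
    intro s hs hs'
    have := mul_le_sin (x := π * s) (by have := pi_pos; positivity [hδ.trans hs])
      (by have := pi_pos; nlinarith)
    have e : 2 / π * (π * s) = 2 * s := by field_simp
    rw [e] at this
    linarith
  rcases le_total t (1 / 2) with h | h
  · exact key t h1 h
  · have := key (1 - t) (by linarith) (by linarith)
    rwa [mul_sub, mul_one, sin_pi_sub] at this

/-! ### The Kuzmin–Landau inequality and the second derivative test -/

lemma norm_inv_one_sub_eC_sub {s t : ℝ} (hs : 0 < s) (hst : s ≤ t) (ht : t < 1) :
    ‖(1 - eC t)⁻¹ - (1 - eC s)⁻¹‖ =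
      (cos (π * s) / sin (π * s) - cos (π * t) / sin (π * t)) / 2 := by
  have hp := pi_pos
  have hs1 : 0 < sin (π * s) := sin_pos_of_pos_of_lt_pi (by positivity) (by nlinarith)
  have ht1 : 0 < sin (π * t) := sin_pos_of_pos_of_lt_pi (by nlinarith) (by nlinarith)
  have hst1 : 0 ≤ sin (π * (t - s)) :=
    sin_nonneg_of_nonneg_of_le_pi (by nlinarith) (by nlinarith)
  have ns : ‖1 - eC s‖ = 2 * sin (π * s) := by rw [norm_one_sub_eC, abs_of_pos hs1]
  have nt : ‖1 - eC t‖ = 2 * sin (π * t) := by rw [norm_one_sub_eC, abs_of_pos ht1]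
  have s0 : 1 - eC s ≠ 0 := by rw [← norm_pos_iff, ns]; positivity
  have t0 : 1 - eC t ≠ 0 := by rw [← norm_pos_iff, nt]; positivity
  rw [inv_sub_inv t0 s0, norm_div, norm_mul, ns, nt]
  have : 1 - eC s - (1 - eC t) = eC t - eC s := by ring
  rw [this, norm_sub_rev, norm_eC_sub_eC, abs_of_nonneg hst1, mul_sub, sin_sub]
  field_simp

/-- The **Kuzmin–Landau inequality** for sequences with monotone first difference. -/
lemma kuzmin_landau_aux {f : ℕ → ℝ} {δ : ℝ} (hδ : 0 < δ) {a b : ℕ}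
    (hmono : ∀ n, a ≤ n → n + 1 < b → f (n + 1) - f n ≤ f (n + 2) - f (n + 1))
    (hf : ∀ n, a ≤ n → n < b → δ ≤ f (n + 1) - f n ∧ f (n + 1) - f n ≤ 1 - δ) :
    ‖∑ n ∈ Ico a b, eC (f n)‖ ≤ 1 / δ := by
  rcases Nat.lt_or_ge a b with hab | hab
  swap
  · rw [Ico_eq_empty_of_le hab]
    simp only [sum_empty, norm_zero]; positivity
  set D : ℕ → ℝ := fun n => f (n + 1) - f n with hD
  have hsin : ∀ n, a ≤ n → n < b → 2 * δ ≤ sin (π * D n) := fun n h1 h2 =>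
    two_mul_le_sin_pi_mul hδ.le (hf n h1 h2).1 (hf n h1 h2).2
  have hw : ∀ n, a ≤ n → n < b → ‖(1 - eC (D n))⁻¹‖ ≤ 1 / (4 * δ) := by
    intro n h1 h2
    have := hsin n h1 h2
    rw [norm_inv, norm_one_sub_eC, abs_of_pos (by linarith), inv_eq_one_div]
    exact one_div_le_one_div_of_le (by positivity) (by linarith)
  have hcot : ∀ n, a ≤ n → n < b → |cos (π * D n) / sin (π * D n)| ≤ 1 / (2 * δ) := by
    intro n h1 h2
    have := hsin n h1 h2
    rw [abs_div, abs_of_pos (show 0 < sin (π * D n) by linarith)]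
    exact div_le_div₀ zero_le_one (abs_cos_le_one _) (by positivity) this
  have key : ∀ m, a + m < b →
      ‖∑ n ∈ Ico a (a + m + 1), eC (f n) + (1 - eC (D (a + m)))⁻¹ * eC (f (a + m + 1))‖
        ≤ ‖(1 - eC (D a))⁻¹‖ + (cos (π * D a) / sin (π * D a) -
            cos (π * D (a + m)) / sin (π * D (a + m))) / 2 := by
    have hid : ∀ n, a ≤ n → n < b →
        eC (f n) + (1 - eC (D n))⁻¹ * eC (f (n + 1)) = (1 - eC (D n))⁻¹ * eC (f n) := by
      intro n h1 h2
      have h0 : 1 - eC (D n) ≠ 0 := by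
        have := hsin n h1 h2
        rw [← norm_pos_iff, norm_one_sub_eC, abs_of_pos (by linarith)]; linarith
      have : eC (f (n + 1)) = eC (D n) * eC (f n) := by rw [← eC_add]; simp [hD]
      rw [this]
      field_simp
      ring
    intro m
    induction m with
    | zero =>
      intro _
      have := hid a le_rfl hab
      simp only [add_zero, Nat.Ico_succ_singleton, sum_singleton, this, norm_mul, norm_eC, mul_one,
        sub_self, zero_div, le_refl]
    | succ m ih =>
      intro hm
      have ih := ih (by omega)
      rw [sum_Ico_succ_top (by omega), add_assoc, ← add_assoc a m 1,
        hid (a + m + 1) (by omega) (by omega)]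
      have e := norm_inv_one_sub_eC_sub (s := D (a + m)) (t := D (a + m + 1))
        (hδ.trans_le (hf _ (by omega) (by omega)).1) (hmono _ (by omega) (by omega))
        (by have := (hf (a + m + 1) (by omega) (by omega)).2; simp only [hD]; linarith)
      have split : ∑ n ∈ Ico a (a + m + 1), eC (f n) +
          (1 - eC (D (a + m + 1)))⁻¹ * eC (f (a + m + 1)) =
          (∑ n ∈ Ico a (a + m + 1), eC (f n) + (1 - eC (D (a + m)))⁻¹ * eC (f (a + m + 1))) +
          ((1 - eC (D (a + m + 1)))⁻¹ - (1 - eC (D (a + m)))⁻¹) * eC (f (a + m + 1)) := by ring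
      rw [split]
      refine (norm_add_le _ _).trans ?_
      rw [norm_mul, norm_eC, mul_one, e]
      linarith
  obtain ⟨m, rfl⟩ : ∃ m, b = a + m + 1 := ⟨b - a - 1, by omega⟩
  have h1 := key m (by omega)
  have h2 := hw a le_rfl hab
  have h3 := hw (a + m) (by omega) (by omega)
  have h4 := abs_le.1 (hcot a le_rfl hab)
  have h5 := abs_le.1 (hcot (a + m) (by omega) (by omega))
  have h6 : ‖(1 - eC (D (a + m)))⁻¹ * eC (f (a + m + 1))‖ ≤ 1 / (4 * δ) := by
    rwa [norm_mul, norm_eC, mul_one]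
  have h7 := norm_le_add_norm_add (∑ n ∈ Ico a (a + m + 1), eC (f n))
    ((1 - eC (D (a + m)))⁻¹ * eC (f (a + m + 1)))
  have h8 : 1 / (4 * δ) = 1 / δ / 4 := by field_simp
  have h9 : 1 / (2 * δ) = 1 / δ / 2 := by field_simp
  linarith [h4.2, h5.1]

lemma kuzmin_landau {f : ℕ → ℝ} {δ : ℝ} (hδ : 0 < δ) {a b : ℕ} (ν : ℤ)
    (hmono : ∀ n, a ≤ n → n + 1 < b → f (n + 1) - f n ≤ f (n + 2) - f (n + 1))
    (hf : ∀ n, a ≤ n → n < b → ν + δ ≤ f (n + 1) - f n ∧ f (n + 1) - f n ≤ ν + 1 - δ) :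
    ‖∑ n ∈ Ico a b, eC (f n)‖ ≤ 1 / δ := by
  have h := kuzmin_landau_aux (f := fun n => f n - (ν * n : ℤ)) hδ (a := a) (b := b) ?_ ?_
  · simpa only [eC_sub_intCast] using h
  · intro n h1 h2
    have := hmono n h1 h2
    push_cast
    linarith
  · intro n h1 h2
    have := hf n h1 h2
    push_cast
    constructor <;> linarith

lemma norm_sum_eC_le_card {ι : Type*} (s : Finset ι) (f : ι → ℝ) :
    ‖∑ n ∈ s, eC (f n)‖ ≤ #s := by
  refine (norm_sum_le _ _).trans ?_
  simp [norm_eC]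

lemma le_of_forall_le_succ_sub {D : ℕ → ℝ} {lam : ℝ} {L : ℕ}
    (hD : ∀ n < L, lam ≤ D (n + 1) - D n) {m n : ℕ} (hmn : m ≤ n) (hn : n ≤ L) :
    lam * ((n : ℝ) - m) ≤ D n - D m := by
  induction n, hmn using Nat.le_induction with
  | base => simp
  | succ n hmn ih =>
    have := ih (by omega)
    have := hD n (by omega)
    push_cast
    linarith

lemma card_le_of_spaced {D : ℕ → ℝ} {lam δ u : ℝ} {L : ℕ} (hlam : 0 < lam) (hδ : 0 ≤ δ)
    (hD : ∀ n < L, lam ≤ D (n + 1) - D n) {S : Finset ℕ} (hS : ∀ n ∈ S, n < L)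
    (hu : ∀ n ∈ S, u ≤ D n ∧ D n ≤ u + δ) : (#S : ℝ) ≤ δ / lam + 1 := by
  rcases S.eq_empty_or_nonempty with rfl | hne
  · simp; positivity
  have h1 := S.min'_mem hne
  have h2 := S.max'_mem hne
  have h3 : S.min' hne ≤ S.max' hne := S.min'_le_max' hne
  have hsub : S ⊆ Icc (S.min' hne) (S.max' hne) := fun x hx =>
    mem_Icc.2 ⟨S.min'_le x hx, S.le_max' x hx⟩
  have hc := card_le_card hsub
  rw [Nat.card_Icc] at hc
  have hc' : (#S : ℝ) ≤ (S.max' hne : ℝ) + 1 - S.min' hne := by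
    have : (#S : ℝ) ≤ ((S.max' hne + 1 - S.min' hne : ℕ) : ℝ) := by exact_mod_cast hc
    rwa [Nat.cast_sub (by omega), Nat.cast_add, Nat.cast_one] at this
  have h4 := le_of_forall_le_succ_sub hD h3 (hS _ h2).le
  have h5 := hu _ h1
  have h6 := hu _ h2
  have : ((S.max' hne : ℝ) - S.min' hne) ≤ δ / lam := by
    rw [le_div_iff₀ hlam]; linarith
  linarith

lemma exists_eq_Ico {S : Finset ℕ} (hS : ∀ x ∈ S, ∀ y ∈ S, ∀ z, x ≤ z → z ≤ y → z ∈ S) :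
    ∃ a b, S = Ico a b := by
  rcases S.eq_empty_or_nonempty with rfl | hne
  · exact ⟨0, 0, by simp⟩
  refine ⟨S.min' hne, S.max' hne + 1, ?_⟩
  ext x
  rw [mem_Ico]
  constructor
  · intro hx
    exact ⟨S.min'_le x hx, Nat.lt_succ_of_le (S.le_max' x hx)⟩
  · rintro ⟨h1, h2⟩
    exact hS _ (S.min'_mem hne) _ (S.max'_mem hne) x h1 (by omega)

/-- The second derivative test for exponential sums, in terms of second differences. -/
lemma second_difference_test {h : ℝ} (hh : 1 ≤ h) {L : ℕ} {lam : ℝ} (hlam : 0 < lam) {f : ℕ → ℝ}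
    (hf : ∀ n < L, lam ≤ f (n + 2) - f (n + 1) - (f (n + 1) - f n) ∧
      f (n + 2) - f (n + 1) - (f (n + 1) - f n) ≤ h * lam) :
    ‖∑ n ∈ range L, eC (f n)‖ ≤ 10 * h * (L * √lam + 1 / √lam) := by
  have hs : 0 < √lam := sqrt_pos.2 hlam
  have hsq : √lam * √lam = lam := mul_self_sqrt hlam.le
  rcases le_total 1 lam with h1 | h1
  · have := norm_sum_eC_le_card (range L) f
    rw [card_range] at this
    have h2 : 1 ≤ √lam := one_le_sqrt.2 h1
    have h3 : (L : ℝ) ≤ L * √lam := le_mul_of_one_le_right (by positivity) h2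
    have h4 : L * √lam + 1 / √lam ≤ 10 * h * (L * √lam + 1 / √lam) :=
      le_mul_of_one_le_left (by positivity) (by linarith)
    have h5 : 0 < 1 / √lam := by positivity
    linarith
  set D : ℕ → ℝ := fun n => f (n + 1) - f n with hDdef
  have hD : ∀ n < L, lam ≤ D (n + 1) - D n := fun n hn => (hf n hn).1
  have hDmono : ∀ m n, m ≤ n → n ≤ L → D m ≤ D n := by
    intro m n hmn hn
    have := le_of_forall_le_succ_sub hD hmn hn
    have h2 : (0 : ℝ) ≤ n - m := by simpa using hmn
    nlinarith
  have hDup : D L - D 0 ≤ h * lam * L := by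
    have := le_of_forall_le_succ_sub (D := fun n => - D n) (lam := -(h * lam)) (L := L)
      (fun n hn => by have := (hf n hn).2; simp only [hDdef]; linarith) (Nat.zero_le L) le_rfl
    simp only [Nat.cast_zero] at this
    linarith
  set δ := √lam with hδ
  have hδ1 : δ ≤ 1 := by rw [hδ]; exact sqrt_le_one.2 h1
  have hfib : ∀ ν : ℤ, ‖∑ n ∈ (range L).filter (fun n => ⌊D n⌋ = ν), eC (f n)‖ ≤ 5 / δ := by
    intro ν
    set s := (range L).filter (fun n => ⌊D n⌋ = ν) with hsdef
    have hmem : ∀ n ∈ s, n < L ∧ (ν : ℝ) ≤ D n ∧ D n < ν + 1 := by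
      intro n hn
      rw [hsdef, mem_filter, mem_range, Int.floor_eq_iff] at hn
      exact hn
    rw [← sum_filter_add_sum_filter_not s (fun n => D n < ν + δ),
      ← sum_filter_add_sum_filter_not (s.filter (fun n => ¬ D n < ν + δ))
        (fun n => ν + 1 - δ < D n)]
    set s1 := s.filter (fun n => D n < ν + δ) with hs1
    set s2 := (s.filter (fun n => ¬ D n < ν + δ)).filter (fun n => ν + 1 - δ < D n) with hs2
    set s3 := (s.filter (fun n => ¬ D n < ν + δ)).filter (fun n => ¬ ν + 1 - δ < D n) with hs3
    have c1 : ‖∑ n ∈ s1, eC (f n)‖ ≤ δ / lam + 1 := by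
      refine (norm_sum_eC_le_card _ _).trans (card_le_of_spaced (u := ν) hlam hs.le hD ?_ ?_)
      · intro n hn; exact (hmem n (mem_filter.1 hn).1).1
      · intro n hn
        have := mem_filter.1 hn
        exact ⟨(hmem n this.1).2.1, this.2.le⟩
    have c2 : ‖∑ n ∈ s2, eC (f n)‖ ≤ δ / lam + 1 := by
      refine (norm_sum_eC_le_card _ _).trans
        (card_le_of_spaced (u := ν + 1 - δ) hlam hs.le hD ?_ ?_)
      · intro n hn; exact (hmem n (mem_filter.1 (mem_filter.1 hn).1).1).1
      · intro n hn
        have := mem_filter.1 hn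
        exact ⟨this.2.le, by linarith [(hmem n (mem_filter.1 this.1).1).2.2]⟩
    have hmem3 : ∀ n, n ∈ s3 ↔ n < L ∧ ν + δ ≤ D n ∧ D n ≤ ν + 1 - δ := by
      intro n
      rw [hs3, mem_filter, mem_filter, not_lt, not_lt]
      constructor
      · rintro ⟨⟨ha, hb⟩, hc⟩
        exact ⟨(hmem n ha).1, hb, hc⟩
      · rintro ⟨ha, hb, hc⟩
        refine ⟨⟨?_, hb⟩, hc⟩
        rw [hsdef, mem_filter, mem_range, Int.floor_eq_iff]
        exact ⟨ha, by linarith, by linarith⟩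
    have c3 : ‖∑ n ∈ s3, eC (f n)‖ ≤ 1 / δ := by
      obtain ⟨a, b, hab⟩ : ∃ a b, s3 = Ico a b := by
        apply exists_eq_Ico
        intro x hx y hy z hxz hzy
        rw [hmem3] at hx hy ⊢
        exact ⟨by omega, hx.2.1.trans (hDmono _ _ hxz (by omega)),
          (hDmono _ _ hzy (by omega)).trans hy.2.2⟩
      rw [hab]
      have hin : ∀ n, a ≤ n → n < b → n ∈ s3 := fun n h1 h2 => by
        rw [hab]; exact mem_Ico.2 ⟨h1, h2⟩
      refine kuzmin_landau hs ν ?_ ?_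
      · intro n h1 h2
        have := (hmem3 n).1 (hin n h1 (by omega))
        exact hDmono n (n + 1) (by omega) (by omega)
      · intro n h1 h2
        exact ((hmem3 n).1 (hin n h1 h2)).2
    have e1 : δ / lam = 1 / δ := by rw [← hsq]; field_simp
    have e2 : 1 ≤ 1 / δ := by rw [le_div_iff₀ hs]; linarith
    have e3 : 5 / δ = 5 * (1 / δ) := by ring
    rw [e1] at c1 c2
    have := norm_add₃_le (a := ∑ n ∈ s1, eC (f n)) (b := ∑ n ∈ s2, eC (f n))
      (c := ∑ n ∈ s3, eC (f n))
    rw [← add_assoc]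
    linarith
  have himg : ∀ n ∈ range L, ⌊D n⌋ ∈ Icc ⌊D 0⌋ ⌊D L⌋ := by
    intro n hn
    have hn := (mem_range.1 hn).le
    exact mem_Icc.2 ⟨Int.floor_mono (hDmono _ _ (Nat.zero_le _) hn),
      Int.floor_mono (hDmono _ _ hn le_rfl)⟩
  rw [← sum_fiberwise_of_maps_to himg]
  have hcard : ((#(Icc ⌊D 0⌋ ⌊D L⌋) : ℕ) : ℝ) ≤ h * lam * L + 2 := by
    have h0 : ⌊D 0⌋ ≤ ⌊D L⌋ := Int.floor_mono (hDmono _ _ (Nat.zero_le _) le_rfl)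
    rw [Int.card_Icc]
    have : (((⌊D L⌋ + 1 - ⌊D 0⌋).toNat : ℤ) : ℝ) = ⌊D L⌋ + 1 - ⌊D 0⌋ := by
      rw [Int.toNat_of_nonneg (by omega)]; push_cast; ring
    rw [Int.cast_natCast] at this
    rw [this]
    have := Int.floor_le (D L)
    have := Int.lt_floor_add_one (D 0)
    linarith
  calc _ ≤ ∑ ν ∈ Icc ⌊D 0⌋ ⌊D L⌋, 5 / δ := (norm_sum_le _ _).trans (sum_le_sum fun ν _ => hfib ν)
    _ = #(Icc ⌊D 0⌋ ⌊D L⌋) * (5 / δ) := by rw [sum_const, nsmul_eq_mul]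
    _ ≤ (h * lam * L + 2) * (5 / δ) := by gcongr
    _ = 5 * h * L * δ + 10 * (1 / δ) := by
      rw [← hsq]; field_simp; ring
    _ ≤ 10 * h * (L * δ + 1 / δ) := by
      have : 0 ≤ h * L * δ := by positivity
      have : 1 / δ ≤ h * (1 / δ) := le_mul_of_one_le_left (by positivity) hh
      linarith

lemma sum_range_shift_ite {E : Type*} [AddCommMonoid E] (F : ℕ → E) {p m T : ℕ} (h : p + m ≤ T) :
    ∑ t ∈ range T, (if p ≤ t ∧ t - p < m then F (t - p) else 0) = ∑ n ∈ range m, F n := by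
  rw [← sum_filter]
  refine sum_nbij' (fun t => t - p) (fun n => n + p) ?_ ?_ ?_ ?_ ?_
  · intro t ht
    exact mem_range.2 (mem_filter.1 ht).2.2
  · intro n hn
    have := mem_range.1 hn
    rw [mem_filter, mem_range]
    omega
  · intro t ht
    have := (mem_filter.1 ht).2.1
    omega
  · intro n _
    simp
  · intro t _
    rfl

lemma sum_range_dist_le {R : ℕ → ℝ} (hR : ∀ r, 0 ≤ R r) {q Q : ℕ} (hq : q < Q) :
    ∑ p ∈ range Q, R (if p ≤ q then q - p else p - q) ≤ R 0 + 2 * ∑ r ∈ Ico 1 Q, R r := by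
  rw [← sum_filter_add_sum_filter_not (range Q) (fun p => p < q),
    ← sum_filter_add_sum_filter_not ((range Q).filter (fun p => ¬ p < q)) (fun p => p = q)]
  have h1 : ∑ p ∈ (range Q).filter (fun p => p < q), R (if p ≤ q then q - p else p - q) ≤
      ∑ r ∈ Ico 1 Q, R r := by
    have : ∑ p ∈ (range Q).filter (fun p => p < q), R (if p ≤ q then q - p else p - q) =
        ∑ r ∈ ((range Q).filter (fun p => p < q)).image (fun p => q - p), R r := by
      rw [sum_image]
      · refine sum_congr rfl fun p hp => ?_
        rw [if_pos (mem_filter.1 hp).2.le]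
      · intro x hx y hy hxy
        have := (mem_filter.1 hx).2
        have := (mem_filter.1 hy).2
        simp only at hxy
        omega
    rw [this]
    refine sum_le_sum_of_subset_of_nonneg ?_ fun r _ _ => hR r
    intro r hr
    obtain ⟨p, hp, rfl⟩ := mem_image.1 hr
    have := (mem_filter.1 hp).2
    rw [mem_Ico]; omega
  have h3 : ∑ p ∈ ((range Q).filter (fun p => ¬ p < q)).filter (fun p => ¬ p = q),
      R (if p ≤ q then q - p else p - q) ≤ ∑ r ∈ Ico 1 Q, R r := by
    have : ∑ p ∈ ((range Q).filter (fun p => ¬ p < q)).filter (fun p => ¬ p = q),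
        R (if p ≤ q then q - p else p - q) =
        ∑ r ∈ (((range Q).filter (fun p => ¬ p < q)).filter
          (fun p => ¬ p = q)).image (fun p => p - q), R r := by
      rw [sum_image]
      · refine sum_congr rfl fun p hp => ?_
        have h := mem_filter.1 hp
        have h' := (mem_filter.1 h.1).2
        rw [if_neg (by omega)]
      · intro x hx y hy hxy
        have h := mem_filter.1 hx
        have h' := (mem_filter.1 h.1).2
        have h := mem_filter.1 hy
        have h' := (mem_filter.1 h.1).2
        simp only at hxy
        omega
    rw [this]
    refine sum_le_sum_of_subset_of_nonneg ?_ fun r _ _ => hR r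
    intro r hr
    obtain ⟨p, hp, rfl⟩ := mem_image.1 hr
    have h := mem_filter.1 hp
    have h' := mem_filter.1 h.1
    have := mem_range.1 h'.1
    rw [mem_Ico]; omega
  have h2 : ∑ p ∈ ((range Q).filter (fun p => ¬ p < q)).filter (fun p => p = q),
      R (if p ≤ q then q - p else p - q) ≤ R 0 := by
    calc _ ≤ ∑ p ∈ ({q} : Finset ℕ), R (if p ≤ q then q - p else p - q) :=
          sum_le_sum_of_subset_of_nonneg
            (fun p hp => mem_singleton.2 (mem_filter.1 hp).2) fun _ _ _ => hR _
      _ = R 0 := by simp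
  linarith

lemma norm_sq_sum_le_card_mul {ι : Type*} (s : Finset ι) (A : ι → ℂ) :
    ‖∑ t ∈ s, A t‖ ^ 2 ≤ #s * ∑ t ∈ s, ‖A t‖ ^ 2 := by
  calc ‖∑ t ∈ s, A t‖ ^ 2 ≤ (∑ t ∈ s, ‖A t‖) ^ 2 := by gcongr; exact norm_sum_le _ _
    _ ≤ _ := sq_sum_le_card_mul_sum_sq

lemma sum_norm_sq_sum_le {ι κ : Type*} (s : Finset ι) (u : Finset κ) (w : ι → κ → ℂ) :
    ∑ t ∈ s, ‖∑ q ∈ u, w t q‖ ^ 2 ≤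
      ∑ q ∈ u, ∑ p ∈ u, ‖∑ t ∈ s, w t q * (starRingEnd ℂ) (w t p)‖ := by
  have h : ((∑ t ∈ s, ‖∑ q ∈ u, w t q‖ ^ 2 : ℝ) : ℂ) =
      ∑ q ∈ u, ∑ p ∈ u, ∑ t ∈ s, w t q * (starRingEnd ℂ) (w t p) := by
    push_cast
    have : ∀ t ∈ s, ((‖∑ q ∈ u, w t q‖ : ℂ)) ^ 2 =
        ∑ q ∈ u, ∑ p ∈ u, w t q * (starRingEnd ℂ) (w t p) := by
      intro t _
      rw [← Complex.mul_conj', map_sum, sum_mul_sum]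
    rw [sum_congr rfl this, sum_comm]
    exact sum_congr rfl fun q _ => sum_comm
  have h0 : 0 ≤ ∑ t ∈ s, ‖∑ q ∈ u, w t q‖ ^ 2 := sum_nonneg fun _ _ => by positivity
  rw [← abs_of_nonneg h0, ← Real.norm_eq_abs, ← Complex.norm_real, h]
  exact (norm_sum_le _ _).trans (sum_le_sum fun q _ => norm_sum_le _ _)

/-- **Van der Corput's inequality** (Weyl differencing). -/
lemma van_der_corput_inequality {z : ℕ → ℂ} (hz : ∀ n, ‖z n‖ ≤ 1) {L Q : ℕ} (hQ : 1 ≤ Q)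
    (hQL : Q ≤ L) :
    ‖∑ n ∈ range L, z n‖ ^ 2 ≤ 2 * L / Q *
      (L + 2 * ∑ q ∈ Ico 1 Q, ‖∑ n ∈ range (L - q), z (n + q) * (starRingEnd ℂ) (z n)‖) := by
  set S := ∑ n ∈ range L, z n with hS
  set R : ℕ → ℝ := fun q => ‖∑ n ∈ range (L - q), z (n + q) * (starRingEnd ℂ) (z n)‖ with hR
  set w : ℕ → ℕ → ℂ := fun t q => if q ≤ t ∧ t - q < L then z (t - q) else 0 with hw
  have hw1 : ∀ q < Q, ∑ t ∈ range (L + Q), w t q = S := fun q hq =>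
    sum_range_shift_ite z (by omega)
  have hle : ∀ q p, q ≤ p → p < Q →
      ∑ t ∈ range (L + Q), w t q * (starRingEnd ℂ) (w t p) =
      ∑ n ∈ range (L - (p - q)), z (n + (p - q)) * (starRingEnd ℂ) (z n) := by
    intro q p hqp hp
    rw [← sum_range_shift_ite (fun n => z (n + (p - q)) * (starRingEnd ℂ) (z n))
      (p := p) (T := L + Q) (by omega)]
    refine sum_congr rfl fun t _ => ?_
    simp only [hw]
    by_cases h1 : p ≤ t ∧ t - p < L - (p - q)
    · rw [if_pos h1, if_pos (by omega), if_pos (by omega)]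
      congr 2
      omega
    · rw [if_neg h1]
      by_cases h2 : p ≤ t ∧ t - p < L
      · rw [if_neg (show ¬ (q ≤ t ∧ t - q < L) by omega), zero_mul]
      · rw [if_neg h2, _root_.map_zero, mul_zero]
  have hw2 : ∀ q < Q, ∀ p < Q, ‖∑ t ∈ range (L + Q), w t q * (starRingEnd ℂ) (w t p)‖ =
      R (if p ≤ q then q - p else p - q) := by
    intro q hq p hp
    split_ifs with h
    · rw [hR]
      simp only
      rw [← hle p q h hq, ← RCLike.norm_conj, map_sum]
      congr 1
      refine sum_congr rfl fun t _ => ?_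
      rw [map_mul, Complex.conj_conj, mul_comm]
    · rw [hR]
      simp only
      rw [← hle q p (by omega) hp]
  have hR0 : R 0 ≤ L := by
    simp only [hR]
    refine (norm_sum_le _ _).trans ?_
    calc _ ≤ ∑ n ∈ range (L - 0), (1 : ℝ) := sum_le_sum fun n _ => by
          rw [norm_mul, RCLike.norm_conj]
          exact mul_le_one₀ (hz _) (norm_nonneg _) (hz _)
      _ = L := by simp
  have hQ0 : (0 : ℝ) < Q := by exact_mod_cast hQ
  have main : (Q : ℝ) ^ 2 * ‖S‖ ^ 2 ≤ (L + Q) * (Q * (L + 2 * ∑ q ∈ Ico 1 Q, R q)) := by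
    have e : (Q : ℂ) * S = ∑ t ∈ range (L + Q), ∑ q ∈ range Q, w t q := by
      rw [sum_comm, sum_congr rfl fun q hq => hw1 q (mem_range.1 hq)]
      simp
    have e2 : (Q : ℝ) ^ 2 * ‖S‖ ^ 2 = ‖(Q : ℂ) * S‖ ^ 2 := by
      rw [norm_mul, Complex.norm_natCast, mul_pow]
    rw [e2, e]
    refine (norm_sq_sum_le_card_mul _ _).trans ?_
    rw [card_range]
    push_cast
    gcongr
    refine (sum_norm_sq_sum_le _ _ _).trans ?_
    calc _ ≤ ∑ q ∈ range Q, (L + 2 * ∑ r ∈ Ico 1 Q, R r) := by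
          refine sum_le_sum fun q hq => ?_
          rw [sum_congr rfl fun p hp => hw2 q (mem_range.1 hq) p (mem_range.1 hp)]
          have := sum_range_dist_le (R := R) (fun r => norm_nonneg _) (mem_range.1 hq)
          linarith
      _ = _ := by rw [sum_const, card_range, nsmul_eq_mul]
  have hB : 0 ≤ L + 2 * ∑ q ∈ Ico 1 Q, R q := by
    have : 0 ≤ ∑ q ∈ Ico 1 Q, R q := sum_nonneg fun r _ => norm_nonneg _
    positivity
  have hQL' : (Q : ℝ) ≤ L := by exact_mod_cast hQL
  have h3 : (Q : ℝ) ^ 2 * ‖S‖ ^ 2 ≤ (2 * L) * (Q * (L + 2 * ∑ q ∈ Ico 1 Q, R q)) :=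
    main.trans (by gcongr; linarith)
  rw [div_mul_eq_mul_div, le_div_iff₀ hQ0]
  have : Q * (‖S‖ ^ 2 * Q) ≤ Q * (2 * L * (L + 2 * ∑ q ∈ Ico 1 Q, R q)) := by linarith
  exact le_of_mul_le_mul_left this hQ0

/-- The statement of a `k`-th derivative test with exponents `a`, `b`: sums of `e(f n)` over
`n < L` are `≪ L λ ^ a + L ^ b λ ^ (-a)` when the `k`-th differences of `f` have size `λ`. -/
def DerivativeTest (k : ℕ) (a b : ℝ) : Prop :=
  ∀ h : ℝ, 1 ≤ h → ∃ C : ℝ, 0 < C ∧ ∀ (L : ℕ) (lam : ℝ) (f : ℕ → ℝ), 0 < lam →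
    (∀ n < L, lam ≤ (fwdDiff 1)^[k] f n ∧ (fwdDiff 1)^[k] f n ≤ h * lam) →
    ‖∑ n ∈ range L, eC (f n)‖ ≤ C * (L * lam ^ a + (L : ℝ) ^ b * lam ^ (-a))

lemma derivativeTest_two : DerivativeTest 2 (1 / 2) 0 := by
  intro h hh
  refine ⟨10 * h, by positivity, fun L lam f hlam hf => ?_⟩
  have := second_difference_test hh hlam (f := f) (L := L) (by
    intro n hn
    simpa [fwdDiff, add_assoc] using hf n hn)
  rwa [rpow_zero, one_mul, rpow_neg hlam.le, ← sqrt_eq_rpow, ← one_div]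

lemma fwdDiff_iter_sub_shift (f : ℕ → ℝ) (k q n : ℕ) :
    (fwdDiff 1)^[k] (fun m => f (m + q) - f m) n =
      ∑ j ∈ range q, (fwdDiff 1)^[k + 1] f (n + j) := by
  have h1 : (fun m => f (m + q) - f m) = (fun m => f (m + q)) + (-1 : ℝ) • f := by
    ext m
    simp [sub_eq_add_neg]
  rw [h1, fwdDiff_iter_add, fwdDiff_iter_const_smul, Pi.add_apply, fwdDiff_iter_comp_add,
    Function.iterate_succ']
  simp only [Function.comp, fwdDiff, Pi.smul_apply, smul_eq_mul]
  have := sum_range_sub (fun j => (fwdDiff 1)^[k] f (n + j)) q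
  simp only [← add_assoc, add_zero] at this
  rw [this]
  ring

lemma sum_rpow_neg_half_le (Q : ℕ) : ∑ q ∈ Ico 1 Q, (q : ℝ) ^ (-(1 / 2 : ℝ)) ≤ 2 * √Q := by
  have key : ∀ n : ℕ, ∑ q ∈ Ico 1 (n + 1), (q : ℝ) ^ (-(1 / 2 : ℝ)) ≤ 2 * √n := by
    intro n
    induction n with
    | zero => simp
    | succ n ih =>
      rw [sum_Ico_succ_top (by omega)]
      have e : ((n + 1 : ℕ) : ℝ) ^ (-(1 / 2 : ℝ)) = 1 / √((n : ℝ) + 1) := by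
        push_cast
        rw [rpow_neg (by positivity), ← sqrt_eq_rpow, one_div]
      rw [e]
      push_cast
      have h0 : 0 < √((n : ℝ) + 1) := sqrt_pos.2 (by positivity)
      have h1 : √(n : ℝ) * √(n : ℝ) = n := mul_self_sqrt (by positivity)
      have h2 : √((n : ℝ) + 1) * √((n : ℝ) + 1) = n + 1 := mul_self_sqrt (by positivity)
      have h3 : 1 / √((n : ℝ) + 1) ≤ 2 * √((n : ℝ) + 1) - 2 * √n := by
        rw [div_le_iff₀ h0]
        nlinarith [sq_nonneg (√((n : ℝ) + 1) - √n)]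
      linarith
  rcases Q with _ | n
  · simp
  · refine (key n).trans ?_
    gcongr
    exact Nat.le_succ n

lemma sum_rpow_neg_le {a : ℝ} (ha : a ≤ 1 / 2) {Q : ℕ} (hQ : 1 ≤ Q) :
    ∑ q ∈ Ico 1 Q, (q : ℝ) ^ (-a) ≤ 2 * (Q : ℝ) ^ (1 - a) := by
  have hQ0 : (0 : ℝ) < Q := by exact_mod_cast hQ
  calc ∑ q ∈ Ico 1 Q, (q : ℝ) ^ (-a)
      ≤ ∑ q ∈ Ico 1 Q, (Q : ℝ) ^ (1 / 2 - a) * (q : ℝ) ^ (-(1 / 2 : ℝ)) := by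
        refine sum_le_sum fun q hq => ?_
        have hq := mem_Ico.1 hq
        have hq0 : (0 : ℝ) < q := by exact_mod_cast hq.1
        have : (q : ℝ) ^ (-a) = (q : ℝ) ^ (1 / 2 - a) * (q : ℝ) ^ (-(1 / 2 : ℝ)) := by
          rw [← rpow_add hq0]; congr 1; ring
        rw [this]
        gcongr
        · linarith
    _ = (Q : ℝ) ^ (1 / 2 - a) * ∑ q ∈ Ico 1 Q, (q : ℝ) ^ (-(1 / 2 : ℝ)) := by rw [mul_sum]
    _ ≤ (Q : ℝ) ^ (1 / 2 - a) * (2 * √Q) := by gcongr; exact sum_rpow_neg_half_le Q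
    _ = 2 * (Q : ℝ) ^ (1 - a) := by
        rw [sqrt_eq_rpow, mul_left_comm, ← rpow_add hQ0]; congr 2; ring

set_option maxHeartbeats 1000000 in
lemma DerivativeTest.succ {k : ℕ} {a b : ℝ} (ha : 0 < a) (ha2 : a ≤ 1 / 2) (hb : 0 ≤ b)
    (H : DerivativeTest k a b) : DerivativeTest (k + 1) (a / (2 * (1 + a))) ((1 + b) / 2) := by
  intro h hh
  obtain ⟨C, hC, H⟩ := H h hh
  refine ⟨16 * C + 4, by positivity, fun L lam f hlam hf => ?_⟩
  set a' := a / (2 * (1 + a)) with ha'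
  have ha'0 : 0 < a' := by positivity
  have hid : (1 - 2 * a') * a = 2 * a' := by rw [ha']; field_simp; ring
  set x := L * lam ^ a' with hx
  set y := (L : ℝ) ^ ((1 + b) / 2) * lam ^ (-a') with hy
  have hx0 : 0 ≤ x := by positivity
  have hy0 : 0 ≤ y := by positivity
  have htriv : ‖∑ n ∈ range L, eC (f n)‖ ≤ L := by
    simpa using norm_sum_eC_le_card (range L) f
  have hxy : x + y ≤ (16 * C + 4) * (x + y) := le_mul_of_one_le_left (by positivity) (by linarith)
  rcases le_or_gt 1 lam with h1 | h1
  · have : (L : ℝ) ≤ x := le_mul_of_one_le_right (by positivity) (one_le_rpow h1 ha'0.le)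
    linarith
  rcases Nat.eq_zero_or_pos L with hL0 | hL0
  · subst hL0
    simp only [range_zero, sum_empty, norm_zero]
    positivity
  have hL1 : (1 : ℝ) ≤ L := by exact_mod_cast hL0
  have hL : (0 : ℝ) < L := by linarith
  set T := lam ^ (-(2 * a')) with hT
  have hT1 : 1 ≤ T := one_le_rpow_of_pos_of_le_one_of_nonpos hlam h1.le (by linarith)
  have hT0 : 0 < T := by linarith
  have hTinv : T⁻¹ = lam ^ (2 * a') := by rw [hT, rpow_neg hlam.le, inv_inv]
  set Q := ⌊T⌋₊ with hQ
  have hQ1 : 1 ≤ Q := Nat.le_floor (by simpa using hT1)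
  have hQ1' : (1 : ℝ) ≤ Q := by exact_mod_cast hQ1
  have hQT : (Q : ℝ) ≤ T := Nat.floor_le hT0.le
  have hTQ : T ≤ 2 * Q := by
    have := Nat.lt_floor_add_one T
    linarith
  have hQ0 : (0 : ℝ) < Q := by linarith
  rcases lt_or_ge L Q with hLQ | hQL
  · have hLT : (L : ℝ) ≤ T := by
      have : (L : ℝ) < Q := by exact_mod_cast hLQ
      linarith
    have h2 : (L : ℝ) ^ (1 / 2 : ℝ) ≤ lam ^ (-a') := by
      calc (L : ℝ) ^ (1 / 2 : ℝ) ≤ T ^ (1 / 2 : ℝ) := by gcongr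
        _ = lam ^ (-a') := by rw [hT, ← rpow_mul hlam.le]; congr 1; ring
    have h3 : (L : ℝ) ≤ y := by
      calc (L : ℝ) = (L : ℝ) ^ (1 : ℝ) := (rpow_one _).symm
        _ ≤ (L : ℝ) ^ ((1 + b) / 2 + 1 / 2) := rpow_le_rpow_of_exponent_le hL1 (by linarith)
        _ = (L : ℝ) ^ ((1 + b) / 2) * (L : ℝ) ^ (1 / 2 : ℝ) := rpow_add hL _ _
        _ ≤ y := by rw [hy]; gcongr
    linarith
  have hvdc := van_der_corput_inequality (z := fun n => eC (f n)) (fun n => (norm_eC _).le) hQ1 hQL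
  have hSq : ∀ q ∈ Ico 1 Q, ‖∑ n ∈ range (L - q), eC (f (n + q)) * (starRingEnd ℂ) (eC (f n))‖ ≤
      C * (L * lam ^ (2 * a') + (L : ℝ) ^ b * lam ^ (-a) * (q : ℝ) ^ (-a)) := by
    intro q hq
    have hq := mem_Ico.1 hq
    have hq0 : (0 : ℝ) < q := by exact_mod_cast hq.1
    have hqQ : (q : ℝ) ≤ Q := by exact_mod_cast hq.2.le
    have h2 := H (L - q) (q * lam) (fun n => f (n + q) - f n) (by positivity) (by
      intro n hn
      rw [fwdDiff_iter_sub_shift]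
      constructor
      · calc (q : ℝ) * lam = ∑ j ∈ range q, lam := by simp
          _ ≤ _ := sum_le_sum fun j hj => (hf _ (by have := mem_range.1 hj; omega)).1
      · calc _ ≤ ∑ j ∈ range q, h * lam :=
              sum_le_sum fun j hj => (hf _ (by have := mem_range.1 hj; omega)).2
          _ = h * (q * lam) := by simp; ring)
    simp only [eC_sub] at h2
    refine h2.trans ?_
    have hLq : ((L - q : ℕ) : ℝ) ≤ L := by exact_mod_cast Nat.sub_le L q
    gcongr C * (?_ + ?_)
    · have : ((q : ℝ) * lam) ^ a ≤ lam ^ (2 * a') := by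
        calc ((q : ℝ) * lam) ^ a ≤ (T * lam) ^ a := by gcongr; linarith
          _ = lam ^ (2 * a') := by
            have : T * lam = lam ^ (1 - 2 * a') := by
              rw [hT, sub_eq_neg_add, rpow_add hlam, rpow_one]
            rw [this, ← rpow_mul hlam.le, hid]
      gcongr
    · rw [mul_rpow hq0.le hlam.le, mul_assoc, mul_comm ((q : ℝ) ^ (-a))]
      gcongr
  have hsum : ∑ q ∈ Ico 1 Q,
      ‖∑ n ∈ range (L - q), eC (f (n + q)) * (starRingEnd ℂ) (eC (f n))‖ ≤
      C * (Q * (L * lam ^ (2 * a')) + (L : ℝ) ^ b * lam ^ (-a) * (2 * (Q : ℝ) ^ (1 - a))) := by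
    refine (sum_le_sum hSq).trans ?_
    rw [← mul_sum, sum_add_distrib]
    gcongr C * (?_ + ?_)
    · rw [sum_const, nsmul_eq_mul, Nat.card_Ico]
      gcongr
      exact Nat.sub_le _ _
    · rw [← mul_sum]
      gcongr
      exact sum_rpow_neg_le ha2 hQ1
  have hxsq : x ^ 2 = L ^ 2 * lam ^ (2 * a') := by
    rw [hx, mul_pow, ← rpow_natCast (lam ^ a'), ← rpow_mul hlam.le]
    congr 2; push_cast; ring
  have hysq : y ^ 2 = L * (L : ℝ) ^ b * lam ^ (-(2 * a')) := by
    rw [hy, mul_pow, ← rpow_natCast (lam ^ (-a')), ← rpow_mul hlam.le, ← rpow_natCast,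
      ← rpow_mul hL.le]
    have : (L : ℝ) * (L : ℝ) ^ b = (L : ℝ) ^ (1 + b) := by rw [rpow_add hL, rpow_one]
    rw [this]
    congr 2 <;> (push_cast; ring)
  have hQinv : 1 / (Q : ℝ) ≤ 2 * lam ^ (2 * a') := by
    rw [← hTinv, div_le_iff₀ hQ0]
    field_simp
    linarith
  have hQa : (Q : ℝ) ^ (1 - a) / Q * lam ^ (-a) ≤ 2 * lam ^ (-(2 * a')) := by
    have e1 : (Q : ℝ) ^ (1 - a) / Q = (Q : ℝ) ^ (-a) := by
      rw [sub_eq_neg_add, rpow_add hQ0, rpow_one]; field_simp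
    have e2 : T / 2 * lam = lam ^ (1 - 2 * a') / 2 := by
      rw [hT, sub_eq_neg_add, rpow_add hlam, rpow_one]; ring
    rw [e1, ← mul_rpow hQ0.le hlam.le]
    calc ((Q : ℝ) * lam) ^ (-a) ≤ (T / 2 * lam) ^ (-a) := by
          apply rpow_le_rpow_of_nonpos (by positivity) _ (by linarith)
          gcongr; linarith
      _ = 2 ^ a * lam ^ (-(2 * a')) := by
          rw [e2, div_rpow (by positivity) (by norm_num), ← rpow_mul hlam.le, mul_neg, hid,
            rpow_neg (by norm_num : (0 : ℝ) ≤ 2), div_inv_eq_mul, mul_comm]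
      _ ≤ 2 * lam ^ (-(2 * a')) := by
          gcongr
          calc (2 : ℝ) ^ a ≤ 2 ^ (1 : ℝ) :=
                rpow_le_rpow_of_exponent_le (by norm_num) (by linarith)
            _ = 2 := rpow_one 2
  have hfin : ‖∑ n ∈ range L, eC (f n)‖ ^ 2 ≤ (4 + 4 * C) * x ^ 2 + 16 * C * y ^ 2 := by
    calc _ ≤ 2 * L / Q * (L + 2 * (C * (Q * (L * lam ^ (2 * a')) +
            (L : ℝ) ^ b * lam ^ (-a) * (2 * (Q : ℝ) ^ (1 - a))))) := by
          refine hvdc.trans ?_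
          gcongr
      _ = 2 * L ^ 2 * (1 / Q) + 4 * C * (L ^ 2 * lam ^ (2 * a')) +
            8 * C * (L * (L : ℝ) ^ b) * ((Q : ℝ) ^ (1 - a) / Q * lam ^ (-a)) := by
          field_simp
          ring
      _ ≤ 2 * L ^ 2 * (2 * lam ^ (2 * a')) + 4 * C * (L ^ 2 * lam ^ (2 * a')) +
            8 * C * (L * (L : ℝ) ^ b) * (2 * lam ^ (-(2 * a'))) := by gcongr
      _ = _ := by rw [hxsq, hysq]; ring
  refine le_of_sq_le_sq (hfin.trans ?_) (by positivity)
  have h16 : 16 * C + 4 ≤ (16 * C + 4) ^ 2 := by nlinarith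
  have hsum2 : x ^ 2 + y ^ 2 ≤ (x + y) ^ 2 := by nlinarith
  calc (4 + 4 * C) * x ^ 2 + 16 * C * y ^ 2 ≤ (16 * C + 4) * (x ^ 2 + y ^ 2) := by
        have h1 : 0 ≤ C * x ^ 2 := by positivity
        have h2 : 0 ≤ y ^ 2 := by positivity
        linarith
    _ ≤ (16 * C + 4) ^ 2 * (x + y) ^ 2 := by gcongr
    _ = _ := by ring

lemma derivativeTest_three : DerivativeTest 3 (1 / 6) (1 / 2) := by
  have := derivativeTest_two.succ (by norm_num) (by norm_num) (by norm_num)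
  norm_num at this
  simpa using this

lemma derivativeTest_four : DerivativeTest 4 (1 / 14) (3 / 4) := by
  have := derivativeTest_three.succ (by norm_num) (by norm_num) (by norm_num)
  norm_num at this
  simpa using this

lemma derivativeTest_five : DerivativeTest 5 (1 / 30) (7 / 8) := by
  have := derivativeTest_four.succ (by norm_num) (by norm_num) (by norm_num)
  norm_num at this
  simpa using this

lemma hasDerivAt_fwdDiff_iter {g g' : ℝ → ℝ} (hg : ∀ y, 0 < y → HasDerivAt g (g' y) y) (k : ℕ)
    {y : ℝ} (hy : 0 < y) : HasDerivAt ((fwdDiff 1)^[k] g) ((fwdDiff 1)^[k] g' y) y := by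
  induction k generalizing y with
  | zero => exact hg y hy
  | succ k ih =>
    rw [Function.iterate_succ_apply', Function.iterate_succ_apply']
    exact ((ih (y := y + 1) (by linarith)).comp_add_const y 1).sub (ih hy)

lemma exists_fwdDiff_iter_rpow_eq (k : ℕ) (p : ℝ) {x : ℝ} (hx : 0 < x) :
    ∃ ξ, x ≤ ξ ∧ ξ ≤ x + k ∧
      (fwdDiff 1)^[k] (fun y : ℝ => y ^ p) x = (∏ i ∈ range k, (p - i)) * ξ ^ (p - k) := by
  induction k generalizing p x with
  | zero => exact ⟨x, le_rfl, by simp, by simp⟩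
  | succ k ih =>
    have hd : ∀ y : ℝ, 0 < y → HasDerivAt ((fwdDiff 1)^[k] (fun y : ℝ => y ^ p))
        (p * (fwdDiff 1)^[k] (fun y : ℝ => y ^ (p - 1)) y) y := by
      intro y hy
      have := hasDerivAt_fwdDiff_iter (g := fun y : ℝ => y ^ p)
        (g' := p • (fun y : ℝ => y ^ (p - 1)))
        (fun y hy => by simpa using hasDerivAt_rpow_const (p := p) (Or.inl hy.ne')) k hy
      rwa [fwdDiff_iter_const_smul, Pi.smul_apply, smul_eq_mul] at this
    obtain ⟨η, hη, hη2⟩ := exists_hasDerivAt_eq_slope _ _ (show x < x + 1 by linarith)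
      (fun y hy => (hd y (hx.trans_le hy.1)).continuousAt.continuousWithinAt)
      (fun y hy => hd y (hx.trans hy.1))
    have hη0 : 0 < η := hx.trans hη.1
    obtain ⟨ξ, h1, h2, h3⟩ := ih (p - 1) hη0
    refine ⟨ξ, hη.1.le.trans h1, ?_, ?_⟩
    · push_cast; linarith [hη.2]
    · rw [Function.iterate_succ_apply', fwdDiff]
      have : x + 1 - x = 1 := by ring
      rw [this, div_one] at hη2
      rw [← hη2, h3, prod_range_succ']
      push_cast
      have e : ∀ i : ℕ, p - 1 - (i : ℝ) = p - (i + 1) := fun i => by ring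
      simp only [e, sub_zero]
      ring

lemma fwdDiff_iter_natCast (B x : ℝ) (g : ℝ → ℝ) (k n : ℕ) :
    (fwdDiff 1)^[k] (fun n : ℕ => B * g (x + n)) n = B * (fwdDiff 1)^[k] g (x + n) := by
  induction k generalizing n with
  | zero => simp
  | succ k ih =>
    rw [Function.iterate_succ_apply', Function.iterate_succ_apply', fwdDiff, fwdDiff, ih, ih]
    push_cast
    rw [add_assoc]
    ring

lemma rpow_mem_of_mem {u K p : ℝ} (hu : 1 ≤ u) (huK : u ≤ K) :
    (K ^ |p|)⁻¹ ≤ u ^ p ∧ u ^ p ≤ K ^ |p| := by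
  have hu0 : 0 < u := by linarith
  have h1 : u ^ |p| ≤ K ^ |p| := by gcongr
  constructor
  · calc (K ^ |p|)⁻¹ ≤ (u ^ |p|)⁻¹ := by gcongr
      _ = u ^ (-|p|) := (rpow_neg hu0.le _).symm
      _ ≤ u ^ p := rpow_le_rpow_of_exponent_le hu (neg_abs_le p)
  · exact (rpow_le_rpow_of_exponent_le hu (le_abs_self p)).trans h1

lemma norm_sum_eC_neg {ι : Type*} (s : Finset ι) (f : ι → ℝ) :
    ‖∑ n ∈ s, eC (-f n)‖ = ‖∑ n ∈ s, eC (f n)‖ := by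
  rw [← RCLike.norm_conj, map_sum]
  simp only [conj_eC, neg_neg]

lemma DerivativeTest.rpow {k : ℕ} {a b : ℝ} (hb : 0 ≤ b) (hb1 : b ≤ 1) (H : DerivativeTest k a b)
    {c : ℝ} (hc : ∏ i ∈ range k, (c - i) ≠ 0) :
    ∃ C : ℝ, 0 < C ∧ ∀ (M B : ℝ) (m L : ℕ), 1 ≤ M → B ≠ 0 → M ≤ m → (m + L : ℝ) ≤ 4 * M + 1 →
      ‖∑ n ∈ range L, eC (B * ((m + n : ℕ) : ℝ) ^ c)‖ ≤
        C * (M * (|B| * M ^ (c - k)) ^ a + M ^ b * (|B| * M ^ (c - k)) ^ (-a)) := by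
  set Ψ := ∏ i ∈ range k, (c - (i : ℝ)) with hΨ
  set κ : ℝ := (4 + k : ℝ) ^ |c - k| with hκ
  have hκ1 : 1 ≤ κ := one_le_rpow (by have : (0 : ℝ) ≤ k := by positivity
                                      linarith) (abs_nonneg _)
  have hκ0 : 0 < κ := by linarith
  have hΨ0 : 0 < |Ψ| := abs_pos.2 hc
  obtain ⟨C, hC, H⟩ := H (κ ^ 2) (one_le_pow₀ hκ1)
  set w := |Ψ| / κ with hw
  have hw0 : 0 < w := by positivity
  refine ⟨C * (4 * w ^ a + 4 * w ^ (-a)), by positivity, fun M B m L hM hB hm hL => ?_⟩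
  have hM0 : 0 < M := by linarith
  have hB0 : 0 < |B| := abs_pos.2 hB
  have hm0 : (0 : ℝ) < m := by linarith
  have key : ∀ B' : ℝ, |B'| = |B| → 0 < B' * Ψ →
      ‖∑ n ∈ range L, eC (B' * ((m + n : ℕ) : ℝ) ^ c)‖ ≤ C * (4 * w ^ a + 4 * w ^ (-a)) *
        (M * (|B| * M ^ (c - k)) ^ a + M ^ b * (|B| * M ^ (c - k)) ^ (-a)) := by
    intro B' hB' hpos
    have hLM : (L : ℝ) ≤ 4 * M := by linarith
    have h1 := H L (w * (|B| * M ^ (c - k))) (fun n => B' * (fun y : ℝ => y ^ c) (m + n))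
      (by positivity) (by
        intro n hn
        rw [show (fwdDiff 1)^[k] (fun n : ℕ => B' * (fun y : ℝ => y ^ c) (m + n)) n = _ from
          fwdDiff_iter_natCast B' m (fun y : ℝ => y ^ c) k n]
        obtain ⟨ξ, hξ1, hξ2, hξ⟩ := exists_fwdDiff_iter_rpow_eq k c
          (show (0 : ℝ) < m + n by positivity)
        have hn' : (n : ℝ) + 1 ≤ L := by exact_mod_cast hn
        have hξM : M ≤ ξ := by
          have : (0 : ℝ) ≤ n := by positivity
          linarith
        have hu1 : 1 ≤ ξ / M := (one_le_div hM0).2 hξM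
        have hu2 : ξ / M ≤ 4 + k := by
          rw [div_le_iff₀ hM0]
          have : (k : ℝ) ≤ k * M := le_mul_of_one_le_right (by positivity) hM
          linarith
        have hu := rpow_mem_of_mem (p := c - k) hu1 hu2
        rw [hξ]
        have e : ξ ^ (c - k) = (ξ / M) ^ (c - k) * M ^ (c - k) := by
          rw [← mul_rpow (by positivity) hM0.le]; congr 1; field_simp
        have e2 : B' * (Ψ * ξ ^ (c - k)) = |Ψ| * (|B| * M ^ (c - k)) * (ξ / M) ^ (c - k) := by
          rw [e, ← hB']
          have : B' * Ψ = |B'| * |Ψ| := by rw [← abs_mul, abs_of_pos hpos]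
          linear_combination ((ξ / M) ^ (c - k) * M ^ (c - k)) * this
        rw [e2]
        have hp : 0 ≤ |Ψ| * (|B| * M ^ (c - k)) := by positivity
        constructor
        · calc w * (|B| * M ^ (c - k)) = |Ψ| * (|B| * M ^ (c - k)) * κ⁻¹ := by rw [hw]; ring
            _ ≤ _ := by gcongr; exact hu.1
        · calc _ ≤ |Ψ| * (|B| * M ^ (c - k)) * κ := by gcongr; exact hu.2
            _ = _ := by rw [hw]; field_simp)
    simp only at h1
    push_cast
    refine h1.trans ?_
    set T := |B| * M ^ (c - k) with hT
    have hT0 : 0 < T := by positivity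
    rw [mul_rpow hw0.le hT0.le, mul_rpow hw0.le hT0.le, mul_assoc C]
    gcongr C * ?_
    have hLb : (L : ℝ) ^ b ≤ 4 * M ^ b := by
      calc (L : ℝ) ^ b ≤ (4 * M) ^ b := by gcongr
        _ = 4 ^ b * M ^ b := mul_rpow (by norm_num) hM0.le
        _ ≤ 4 * M ^ b := by
          gcongr
          calc (4 : ℝ) ^ b ≤ 4 ^ (1 : ℝ) := rpow_le_rpow_of_exponent_le (by norm_num) hb1
            _ = 4 := rpow_one 4
    have p1 : 0 < w ^ a := by positivity
    have p2 : 0 < w ^ (-a) := by positivity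
    have p3 : 0 < M * T ^ a := by positivity
    have p4 : 0 < M ^ b * T ^ (-a) := by positivity
    calc L * (w ^ a * T ^ a) + (L : ℝ) ^ b * (w ^ (-a) * T ^ (-a))
        ≤ 4 * M * (w ^ a * T ^ a) + 4 * M ^ b * (w ^ (-a) * T ^ (-a)) := by gcongr
      _ ≤ _ := by nlinarith [mul_pos p1 p4, mul_pos p2 p3]
  rcases lt_or_gt_of_ne (mul_ne_zero hB hc) with h | h
  · have := key (-B) (abs_neg B) (by linarith)
    simp only [neg_mul] at this
    rwa [norm_sum_eC_neg] at this
  · exact key B rfl h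

lemma rpow_div_log {X M : ℝ} (hX : 1 < X) (hM : 0 < M) : X ^ (log M / log X) = M := by
  rw [rpow_def_of_pos (by linarith), mul_div_cancel₀ _ (log_pos hX).ne', exp_log hM]

/-- A uniform power saving for `∑ e(B n ^ c)` over subintervals of `[M, 4 * M]`. -/
lemma exists_norm_sum_rpow_le {c : ℝ} (hc1 : 1 < c) (hc2 : c < 3) (hc3 : c ≠ 2) :
    ∃ C : ℝ, 0 < C ∧ ∀ (X M B : ℝ) (m L : ℕ), 1 < X → 1 ≤ M → X ^ (0.49 : ℝ) ≤ M →
      X ^ (0.175 : ℝ) ≤ |B| * M ^ c → |B| * M ^ c ≤ M ^ 5 * X ^ (-0.8712 : ℝ) →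
      M ≤ m → (m + L : ℝ) ≤ 4 * M + 1 →
      ‖∑ n ∈ range L, eC (B * ((m + n : ℕ) : ℝ) ^ c)‖ ≤ C * (M * X ^ (-0.02904 : ℝ)) := by
  have n0 : c ≠ 0 := by linarith
  have n1 : c - 1 ≠ 0 := by linarith
  have n2 : c - 2 ≠ 0 := sub_ne_zero.2 hc3
  have n3 : c - 3 ≠ 0 := by linarith
  have n4 : c - 4 ≠ 0 := by linarith
  obtain ⟨C3, hC3, H3⟩ := derivativeTest_three.rpow (by norm_num) (by norm_num) (c := c) (by
    simp [prod_range_succ, n0, n1, n2])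
  obtain ⟨C4, hC4, H4⟩ := derivativeTest_four.rpow (by norm_num) (by norm_num) (c := c) (by
    simp [prod_range_succ, n0, n1, n2, n3])
  obtain ⟨C5, hC5, H5⟩ := derivativeTest_five.rpow (by norm_num) (by norm_num) (c := c) (by
    simp [prod_range_succ, n0, n1, n2, n3, n4])
  refine ⟨2 * (C3 + C4 + C5), by positivity, fun X M B m L hX hM hXM hlo hhi hm hL => ?_⟩
  have hX0 : 0 < X := by linarith
  have hM0 : 0 < M := by linarith
  have hG0 : 0 < |B| * M ^ c := lt_of_lt_of_le (by positivity) hlo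
  have hB : B ≠ 0 := by
    rintro rfl
    simp at hG0
  obtain ⟨μ, hμ⟩ : ∃ μ : ℝ, X ^ μ = M := ⟨_, rpow_div_log hX hM0⟩
  obtain ⟨φ, hφ⟩ : ∃ φ : ℝ, X ^ φ = |B| * M ^ c := ⟨_, rpow_div_log hX hG0⟩
  have hk : ∀ k : ℕ, |B| * M ^ (c - k) = X ^ (φ - k * μ) := by
    intro k
    rw [rpow_sub hM0, rpow_sub hX0, hφ, mul_comm (k : ℝ) μ, rpow_mul hX0.le, hμ]
    ring
  have hfin : ∀ (k : ℕ) (a b C : ℝ), 0 < C → C ≤ C3 + C4 + C5 →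
      μ + (φ - k * μ) * a ≤ μ - 0.02904 → μ * b + (φ - k * μ) * (-a) ≤ μ - 0.02904 →
      C * (M * (|B| * M ^ (c - k)) ^ a + M ^ b * (|B| * M ^ (c - k)) ^ (-a)) ≤
        2 * (C3 + C4 + C5) * (M * X ^ (-0.02904 : ℝ)) := by
    intro k a b C hC hCC h1 h2
    have e : M * X ^ (-0.02904 : ℝ) = X ^ (μ - 0.02904) := by
      rw [sub_eq_add_neg, rpow_add hX0, hμ]
    rw [hk, e]
    have e1 : M * (X ^ (φ - k * μ)) ^ a ≤ X ^ (μ - 0.02904) := by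
      rw [← hμ, ← rpow_mul hX0.le, ← rpow_add hX0]
      exact rpow_le_rpow_of_exponent_le hX.le h1
    have e2 : M ^ b * (X ^ (φ - k * μ)) ^ (-a) ≤ X ^ (μ - 0.02904) := by
      rw [← hμ, ← rpow_mul hX0.le, ← rpow_mul hX0.le, ← rpow_add hX0]
      exact rpow_le_rpow_of_exponent_le hX.le h2
    calc _ ≤ C * (X ^ (μ - 0.02904) + X ^ (μ - 0.02904)) := by gcongr
      _ ≤ (C3 + C4 + C5) * (X ^ (μ - 0.02904) + X ^ (μ - 0.02904)) := by gcongr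
      _ = _ := by ring
  have hμ49 : 0.49 ≤ μ := by
    rw [← hμ] at hXM
    exact (rpow_le_rpow_left_iff hX).1 hXM
  have hφlo : 0.175 ≤ φ := by
    rw [← hφ] at hlo
    exact (rpow_le_rpow_left_iff hX).1 hlo
  have hφhi : φ ≤ 5 * μ - 0.8712 := by
    rw [← hφ, ← hμ, ← rpow_natCast, ← rpow_mul hX0.le, ← rpow_add hX0] at hhi
    have := (rpow_le_rpow_left_iff hX).1 hhi
    push_cast at this
    linarith
  by_cases h3 : φ ≤ 3 * μ - 0.17424
  · refine (H3 M B m L hM hB hm hL).trans (hfin 3 _ _ C3 hC3 (by linarith) ?_ ?_) <;>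
      push_cast <;> linarith
  by_cases h4 : φ ≤ 4 * μ - 0.40656
  · refine (H4 M B m L hM hB hm hL).trans (hfin 4 _ _ C4 hC4 (by linarith) ?_ ?_) <;>
      push_cast <;> linarith
  · refine (H5 M B m L hM hB hm hL).trans (hfin 5 _ _ C5 hC5 (by linarith) ?_ ?_) <;>
      push_cast <;> linarith

/-- The estimate of `exists_norm_sum_rpow_le` for sums over convex sets of integers. -/
lemma exists_norm_sum_rpow_le_of_convex {c : ℝ} (hc1 : 1 < c) (hc2 : c < 3) (hc3 : c ≠ 2) :
    ∃ C : ℝ, 0 < C ∧ ∀ (X M B : ℝ) (S : Finset ℕ), 1 < X → 1 ≤ M → X ^ (0.49 : ℝ) ≤ M →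
      X ^ (0.175 : ℝ) ≤ |B| * M ^ c → |B| * M ^ c ≤ M ^ 5 * X ^ (-0.8712 : ℝ) →
      (∀ x ∈ S, ∀ y ∈ S, ∀ z, x ≤ z → z ≤ y → z ∈ S) → (∀ x ∈ S, M ≤ x ∧ (x : ℝ) ≤ 4 * M) →
      ‖∑ n ∈ S, eC (B * (n : ℝ) ^ c)‖ ≤ C * (M * X ^ (-0.02904 : ℝ)) := by
  obtain ⟨C, hC, H⟩ := exists_norm_sum_rpow_le hc1 hc2 hc3
  refine ⟨C, hC, fun X M B S hX hM hXM h1 h2 hS hSM => ?_⟩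
  obtain ⟨a, b, rfl⟩ := exists_eq_Ico hS
  rcases le_or_gt b a with hab | hab
  · rw [Ico_eq_empty_of_le hab]
    simp only [sum_empty, norm_zero]
    positivity
  · have ha := (hSM a (by simp [hab])).1
    have hb := (hSM (b - 1) (by simp; omega)).2
    rw [sum_Ico_eq_sum_range]
    refine H X M B a (b - a) hX hM hXM h1 h2 ha ?_
    have : ((a : ℝ) + (b - a : ℕ)) = ((b - 1 : ℕ) : ℝ) + 1 := by
      norm_cast; omega
    linarith

lemma exists_rpow_sub_rpow_eq (c : ℝ) {x y : ℝ} (hx : 0 < x) (hxy : x < y) :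
    ∃ ξ ∈ Set.Ioo x y, y ^ c - x ^ c = c * ξ ^ (c - 1) * (y - x) := by
  obtain ⟨ξ, hξ, h⟩ := exists_hasDerivAt_eq_slope (fun t : ℝ => t ^ c) (fun t => c * t ^ (c - 1)) hxy
    (fun t ht => (Real.continuousAt_rpow_const t c
      (Or.inl (hx.trans_le ht.1).ne')).continuousWithinAt)
    (fun t ht => Real.hasDerivAt_rpow_const (Or.inl (hx.trans ht.1).ne'))
  refine ⟨ξ, hξ, ?_⟩
  rw [h, div_mul_cancel₀]
  linarith

lemma abs_rpow_sub_rpow_bounds {c : ℝ} (hc1 : 1 < c) {N K : ℝ} (hN : 0 < N) {p q : ℕ}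
    (hpq : p ≠ q) (hp : N ≤ p) (hq : N ≤ q) (hp' : (p : ℝ) ≤ K) (hq' : (q : ℝ) ≤ K) {D : ℝ}
    (hD : |(q : ℝ) - p| ≤ D) :
    N ^ (c - 1) ≤ |(q : ℝ) ^ c - (p : ℝ) ^ c| ∧
      |(q : ℝ) ^ c - (p : ℝ) ^ c| ≤ c * K ^ (c - 1) * D := by
  wlog h : p < q generalizing p q
  · have := this hpq.symm hq hp hq' hp' (by rwa [abs_sub_comm]) (by omega)
    rwa [abs_sub_comm]
  have hpq' : (p : ℝ) + 1 ≤ q := by exact_mod_cast h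
  obtain ⟨ξ, hξ, e⟩ := exists_rpow_sub_rpow_eq c (hN.trans_le hp) (by linarith : (p : ℝ) < q)
  have hξ0 : N ≤ ξ := hp.trans hξ.1.le
  have h1 : N ^ (c - 1) ≤ ξ ^ (c - 1) := rpow_le_rpow hN.le hξ0 (by linarith)
  have h2 : ξ ^ (c - 1) ≤ K ^ (c - 1) :=
    rpow_le_rpow (hN.le.trans hξ0) (hξ.2.le.trans hq') (by linarith)
  have h3 : 0 < N ^ (c - 1) := rpow_pos_of_pos hN _
  have h4 := le_of_abs_le hD
  rw [e, abs_of_nonneg (by have := h3.trans_le h1; have : 0 ≤ (q:ℝ) - p := by linarith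
                           positivity)]
  constructor
  · nlinarith [mul_nonneg (by linarith : 0 ≤ c - 1) (h3.trans_le h1).le]
  · have h5 := (h3.trans_le h1).trans_le h2
    have h6 : 0 ≤ (q : ℝ) - p := by linarith
    have h7 : 0 ≤ c := by linarith
    gcongr

/-- Cauchy's inequality for a bilinear form whose inner variable is split into blocks of
length `Q`. -/
lemma norm_sq_bilinear_le {s t : Finset ℕ} {a b : ℕ → ℂ} {φ : ℕ → ℕ → ℂ} {Q H : ℕ} (hQ : 0 < Q)
    (ht : ∀ n ∈ t, n ≤ H) {D T : ℝ} (hD : ∀ q ∈ t, ‖∑ m ∈ s, φ m q * starRingEnd ℂ (φ m q)‖ ≤ D)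
    (hT0 : 0 ≤ T) (hT : ∀ q ∈ t, ∀ p ∈ t, p ≠ q → |(q : ℝ) - p| ≤ Q →
      ‖∑ m ∈ s, φ m q * starRingEnd ℂ (φ m p)‖ ≤ T) :
    ‖∑ m ∈ s, ∑ n ∈ t, a m * b n * φ m n‖ ^ 2 ≤
      (∑ m ∈ s, ‖a m‖ ^ 2) * ((H / Q + 1 : ℕ) * ((D + Q * T) * ∑ n ∈ t, ‖b n‖ ^ 2)) := by
  have h1 : ‖∑ m ∈ s, ∑ n ∈ t, a m * b n * φ m n‖ ^ 2 ≤
      (∑ m ∈ s, ‖a m‖ ^ 2) * ∑ m ∈ s, ‖∑ n ∈ t, b n * φ m n‖ ^ 2 := by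
    have : ‖∑ m ∈ s, ∑ n ∈ t, a m * b n * φ m n‖ ≤ ∑ m ∈ s, ‖a m‖ * ‖∑ n ∈ t, b n * φ m n‖ := by
      refine (norm_sum_le _ _).trans (sum_le_sum fun m _ => ?_)
      rw [← norm_mul, mul_sum]
      simp only [mul_assoc, le_refl]
    calc _ ≤ (∑ m ∈ s, ‖a m‖ * ‖∑ n ∈ t, b n * φ m n‖) ^ 2 := by gcongr
      _ ≤ _ := sum_mul_sq_le_sq_mul_sq _ _ _
  refine h1.trans ?_
  gcongr
  set J := range (H / Q + 1) with hJ
  have hmaps : ∀ n ∈ t, n / Q ∈ J := fun n hn => by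
    rw [hJ, mem_range]
    exact Nat.lt_succ_of_le (Nat.div_le_div_right (ht n hn))
  have hsplit : ∀ F : ℕ → ℝ, ∑ j ∈ J, ∑ n ∈ t with n / Q = j, F n = ∑ n ∈ t, F n :=
    fun F => sum_fiberwise_of_maps_to hmaps F
  have h2 : ∀ m ∈ s, ‖∑ n ∈ t, b n * φ m n‖ ^ 2 ≤
      (H / Q + 1 : ℕ) * ∑ j ∈ J, ‖∑ n ∈ t with n / Q = j, b n * φ m n‖ ^ 2 := fun m _ => by
    rw [← sum_fiberwise_of_maps_to hmaps]
    have := norm_sq_sum_le_card_mul J (fun j => ∑ n ∈ t with n / Q = j, b n * φ m n)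
    rwa [hJ, card_range] at this
  refine (sum_le_sum h2).trans ?_
  rw [← mul_sum, sum_comm]
  gcongr
  rw [← hsplit, mul_sum]
  gcongr with j hj
  refine (sum_norm_sq_sum_le s _ (fun m q => b q * φ m q)).trans ?_
  set u := {n ∈ t | n / Q = j} with hu
  have hcard : (#u : ℝ) ≤ Q := by
    have : u ⊆ Ico (j * Q) (j * Q + Q) := fun n hn => by
      simp only [hu, mem_filter] at hn
      have h5 := Nat.div_add_mod n Q
      have h6 := Nat.mod_lt n hQ
      rw [hn.2, mul_comm] at h5
      rw [mem_Ico]; omega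
    have := card_le_card this
    simp only [Nat.card_Ico, add_tsub_cancel_left] at this
    exact_mod_cast this
  have hpair : ∀ q ∈ u, ∀ p ∈ u,
      ‖∑ m ∈ s, b q * φ m q * starRingEnd ℂ (b p * φ m p)‖ ≤
        (if q = p then ‖b q‖ ^ 2 * D else 0) + ‖b q‖ * ‖b p‖ * T := by
    intro q hq p hp
    have e : ∑ m ∈ s, b q * φ m q * starRingEnd ℂ (b p * φ m p) =
        b q * starRingEnd ℂ (b p) * ∑ m ∈ s, φ m q * starRingEnd ℂ (φ m p) := by
      rw [mul_sum]
      refine sum_congr rfl fun m _ => ?_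
      rw [map_mul]; ring
    rw [e, norm_mul, norm_mul, RCLike.norm_conj]
    simp only [hu, mem_filter] at hq hp
    split_ifs with hqp
    · subst hqp
      have := hD q hq.1
      calc _ ≤ ‖b q‖ * ‖b q‖ * D := by gcongr
        _ = ‖b q‖ ^ 2 * D + 0 := by ring
        _ ≤ _ := by gcongr; positivity
    · rw [zero_add]
      gcongr
      refine hT q hq.1 p hp.1 (Ne.symm hqp) ?_
      have h5 := Nat.div_add_mod q Q
      have h6 := Nat.mod_lt q hQ
      have h7 := Nat.div_add_mod p Q
      have h8 := Nat.mod_lt p hQ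
      rw [hq.2] at h5
      rw [hp.2] at h7
      rw [abs_le]
      constructor
      · have : p ≤ q + Q := by omega
        have : (p : ℝ) ≤ q + Q := by exact_mod_cast this
        linarith
      · have : q ≤ p + Q := by omega
        have : (q : ℝ) ≤ p + Q := by exact_mod_cast this
        linarith
  refine (sum_le_sum fun q hq => sum_le_sum fun p hp => hpair q hq p hp).trans ?_
  have h3 : ∑ q ∈ u, ∑ p ∈ u, ((if q = p then ‖b q‖ ^ 2 * D else 0) + ‖b q‖ * ‖b p‖ * T) =
      D * ∑ q ∈ u, ‖b q‖ ^ 2 + T * (∑ q ∈ u, ‖b q‖) ^ 2 := by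
    simp only [sum_add_distrib, sum_ite_eq]
    congr 1
    · rw [mul_sum]
      refine sum_congr rfl fun q hq => ?_
      rw [if_pos hq, mul_comm]
    · rw [sq, sum_mul_sum, mul_sum]
      refine sum_congr rfl fun q _ => ?_
      rw [mul_sum]
      refine sum_congr rfl fun p _ => ?_
      ring
  have h4 : (∑ q ∈ u, ‖b q‖) ^ 2 ≤ Q * ∑ q ∈ u, ‖b q‖ ^ 2 :=
    (sq_sum_le_card_mul_sum_sq).trans (by gcongr)
  rw [h3]
  calc _ ≤ D * ∑ q ∈ u, ‖b q‖ ^ 2 + T * (Q * ∑ q ∈ u, ‖b q‖ ^ 2) := by gcongr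
    _ = _ := by ring

lemma exists_bilinear_rpow_le {c : ℝ} (hc1 : 1 < c) (hc2 : c < 4109054 / 1999527) (hc3 : c ≠ 2) :
    ∃ C : ℝ, 0 < C ∧ ∀ᶠ X : ℝ in Filter.atTop, ∀ θ M N : ℝ, X ^ (0.93 : ℝ) ≤ |θ| * X ^ c →
      |θ| ≤ X ^ (0.0436 : ℝ) → M * N = X / 2 → X ^ (0.4999 : ℝ) ≤ M → X ^ (0.04 : ℝ) ≤ N →
      ∀ (s t : Finset ℕ) (a b : ℕ → ℂ), (∀ m ∈ s, M ≤ m ∧ (m : ℝ) ≤ 4 * M) →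
      (∀ n ∈ t, N ≤ n ∧ (n : ℝ) ≤ 4 * N) →
      (∀ x ∈ s, ∀ y ∈ s, ∀ z, x ≤ z → z ≤ y → z ∈ s) →
      ‖∑ m ∈ s, ∑ n ∈ t, a m * b n *
          (if X < m * n ∧ (m * n : ℝ) ≤ 2 * X then eC (θ * (m * n : ℝ) ^ c) else 0)‖ ^ 2 ≤
        C * X ^ (1 - 0.02904 : ℝ) * (∑ m ∈ s, ‖a m‖ ^ 2) * ∑ n ∈ t, ‖b n‖ ^ 2 := by
  obtain ⟨C, hC, H⟩ := exists_norm_sum_rpow_le_of_convex hc1 (by linarith) hc3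
  refine ⟨5 * (4 + 2 * C), by positivity, ?_⟩
  have ev1 := (tendsto_rpow_atTop (show (0:ℝ) < 0.0007 by norm_num)).eventually_ge_atTop 24
  have ev2 := (tendsto_rpow_atTop (show (0:ℝ) < 0.25 by norm_num)).eventually_ge_atTop 8
  have ev3 := (tendsto_rpow_atTop (show (0:ℝ) < 0.01 by norm_num)).eventually_ge_atTop 2
  filter_upwards [ev1, ev2, ev3, Filter.eventually_gt_atTop 1] with X e1 e2 e3 hX
  intro θ M N hθ1 hθ2 hMN hM hN s t a b hs ht hconv
  have hX0 : 0 < X := by linarith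
  have hM1 : 1 ≤ M := (one_le_rpow hX.le (by norm_num)).trans hM
  have hN1 : 1 ≤ N := (one_le_rpow hX.le (by norm_num)).trans hN
  have hM0 : 0 < M := by linarith
  have hN0 : 0 < N := by linarith
  set Y := X ^ (0.02904 : ℝ) with hY
  have hY1 : 1 ≤ Y := one_le_rpow hX.le (by norm_num)
  set Q := ⌈Y⌉₊ with hQdef
  have hQ1 : Y ≤ Q := Nat.le_ceil _
  have hQ2 : (Q : ℝ) ≤ 2 * Y := by
    have := Nat.ceil_lt_add_one (by linarith : 0 ≤ Y)
    linarith
  have hQ0 : 0 < Q := Nat.ceil_pos.2 (by linarith)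
  have hYN : 2 * Y ≤ N := by
    calc 2 * Y ≤ X ^ (0.01 : ℝ) * X ^ (0.02904 : ℝ) := by gcongr
      _ = X ^ (0.01 + 0.02904 : ℝ) := by rw [rpow_add hX0]
      _ ≤ X ^ (0.04 : ℝ) := rpow_le_rpow_of_exponent_le hX.le (by norm_num)
      _ ≤ N := hN
  have hMs : (#s : ℝ) ≤ 4 * M := by
    have : s ⊆ Ioc 0 ⌊4 * M⌋₊ := fun m hm => by
      rw [mem_Ioc]
      refine ⟨?_, Nat.le_floor (hs m hm).2⟩
      have := (hs m hm).1
      exact_mod_cast hM0.trans_le this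
    have := card_le_card this
    rw [Nat.card_Ioc, tsub_zero] at this
    calc (#s : ℝ) ≤ (⌊4 * M⌋₊ : ℝ) := by exact_mod_cast this
      _ ≤ 4 * M := Nat.floor_le (by positivity)
  have hkey := norm_sq_bilinear_le (s := s) (t := t) (a := a) (b := b)
    (φ := fun m n => if X < m * n ∧ (m * n : ℝ) ≤ 2 * X then eC (θ * (m * n : ℝ) ^ c) else 0)
    (Q := Q) (H := ⌊4 * N⌋₊) hQ0 (fun n hn => Nat.le_floor (ht n hn).2) (D := 4 * M)
    (T := C * (M * X ^ (-0.02904 : ℝ))) ?_ (by positivity) ?_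
  · refine hkey.trans ?_
    have hJ : ((⌊4 * N⌋₊ / Q + 1 : ℕ) : ℝ) ≤ 5 * N / Y := by
      push_cast
      have h1 : ((⌊4 * N⌋₊ / Q : ℕ) : ℝ) ≤ 4 * N / Y := by
        refine Nat.cast_div_le.trans ?_
        have := Nat.floor_le (by positivity : 0 ≤ 4 * N)
        gcongr
      have h2 : 1 ≤ N / Y := by rw [le_div_iff₀ (by linarith)]; linarith
      calc _ ≤ 4 * N / Y + N / Y := add_le_add h1 h2
        _ = _ := by ring
    have hYinv : X ^ (-0.02904 : ℝ) = 1 / Y := by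
      rw [rpow_neg hX0.le, one_div]
    have hT : 4 * M + Q * (C * (M * X ^ (-0.02904 : ℝ))) ≤ (4 + 2 * C) * M := by
      have : Q * (C * (M * X ^ (-0.02904 : ℝ))) ≤ 2 * Y * (C * (M * X ^ (-0.02904 : ℝ))) := by
        gcongr
      have e : 2 * Y * (C * (M * X ^ (-0.02904 : ℝ))) = 2 * C * M := by
        rw [hYinv]; field_simp
      linarith
    have hXY : X ^ (1 - 0.02904 : ℝ) = X / Y := by rw [rpow_sub hX0, rpow_one]
    calc _ ≤ (∑ m ∈ s, ‖a m‖ ^ 2) * (5 * N / Y * (((4 + 2 * C) * M) * ∑ n ∈ t, ‖b n‖ ^ 2)) := by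
          gcongr
      _ = 5 * (4 + 2 * C) * ((M * N) / Y) * (∑ m ∈ s, ‖a m‖ ^ 2) * ∑ n ∈ t, ‖b n‖ ^ 2 := by ring
      _ ≤ _ := by
          rw [hMN, hXY]
          gcongr
          linarith
  · intro q hq
    refine (norm_sum_le _ _).trans ?_
    calc _ ≤ ∑ m ∈ s, (1 : ℝ) := by
          refine sum_le_sum fun m _ => ?_
          split_ifs
          · rw [norm_mul, RCLike.norm_conj, norm_eC, one_mul]
          · simp
      _ ≤ _ := by simpa using hMs
  · intro q hq p hp hpq hqp
    have hq0 : (0 : ℝ) < q := hN0.trans_le (ht q hq).1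
    have hp0 : (0 : ℝ) < p := hN0.trans_le (ht p hp).1
    set S := s.filter fun m : ℕ => (X < m * q ∧ (m * q : ℝ) ≤ 2 * X) ∧
      (X < m * p ∧ (m * p : ℝ) ≤ 2 * X)
      with hS
    have e : ∑ m ∈ s, (if X < m * q ∧ (m * q : ℝ) ≤ 2 * X then eC (θ * (m * q : ℝ) ^ c) else 0) *
        starRingEnd ℂ (if X < m * p ∧ (m * p : ℝ) ≤ 2 * X then eC (θ * (m * p : ℝ) ^ c) else 0) =
        ∑ m ∈ S, eC (θ * ((q : ℝ) ^ c - (p : ℝ) ^ c) * (m : ℝ) ^ c) := by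
      rw [hS, sum_filter]
      refine sum_congr rfl fun m hm => ?_
      by_cases h1 : X < m * q ∧ (m * q : ℝ) ≤ 2 * X
      · by_cases h2 : X < m * p ∧ (m * p : ℝ) ≤ 2 * X
        · rw [if_pos h1, if_pos h2, if_pos ⟨h1, h2⟩, ← eC_sub]
          congr 1
          rw [mul_rpow (by positivity) hq0.le, mul_rpow (by positivity) hp0.le]
          ring
        · rw [if_neg h2, if_neg (not_and_of_not_right _ h2), _root_.map_zero, mul_zero]
      · rw [if_neg h1, if_neg (not_and_of_not_left _ h1), zero_mul]
    rw [e]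
    obtain ⟨hlow, hup⟩ := abs_rpow_sub_rpow_bounds hc1 hN0 hpq (ht p hp).1 (ht q hq).1
      (ht p hp).2 (ht q hq).2 hqp
    have hNc : N ^ (c - 1) * M ^ c = (X / 2) ^ c / N := by
      rw [← hMN, mul_rpow hM0.le hN0.le, rpow_sub hN0, rpow_one]
      ring
    have hNc' : (4 * N) ^ (c - 1) * M ^ c = (2 * X) ^ (c - 1) * M := by
      have : M ^ c = M ^ (c - 1) * M := by
        rw [rpow_sub hM0, rpow_one]; field_simp
      rw [this, ← mul_assoc, ← mul_rpow (by positivity) hM0.le]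
      congr 2
      linarith
    have h2c : (2 : ℝ) ^ (c - 1) ≤ 4 := by
      calc (2 : ℝ) ^ (c - 1) ≤ 2 ^ (2 : ℝ) := rpow_le_rpow_of_exponent_le (by norm_num) (by linarith)
        _ = 4 := by norm_num
    refine H X M (θ * ((q : ℝ) ^ c - (p : ℝ) ^ c)) S hX hM1
      ((rpow_le_rpow_of_exponent_le hX.le (by norm_num)).trans hM) ?_ ?_ ?_ ?_
    · have h8 : (2 : ℝ) ^ c ≤ 8 := by
        calc (2 : ℝ) ^ c ≤ 2 ^ (3 : ℝ) := rpow_le_rpow_of_exponent_le (by norm_num) (by linarith)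
          _ = 8 := by norm_num
      have hNX : N ≤ X ^ (0.5001 : ℝ) := by
        have h1 : X ^ (0.4999 : ℝ) * N ≤ X ^ (0.4999 : ℝ) * X ^ (0.5001 : ℝ) := by
          rw [← rpow_add hX0]
          norm_num
          have : X ^ (4999 / 10000 : ℝ) * N ≤ M * N := by
            gcongr
            norm_num at hM
            exact hM
          linarith
        exact le_of_mul_le_mul_left h1 (by positivity)
      calc X ^ (0.175 : ℝ) ≤ X ^ (0.93 - 0.5001 - 0.25 : ℝ) :=
            rpow_le_rpow_of_exponent_le hX.le (by norm_num)
        _ = X ^ (0.93 : ℝ) / X ^ (0.5001 : ℝ) / X ^ (0.25 : ℝ) := by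
            rw [rpow_sub hX0, rpow_sub hX0]
        _ ≤ |θ| * X ^ c / N / 2 ^ c := by
            gcongr
            exact h8.trans e2
        _ = |θ| * (N ^ (c - 1) * M ^ c) := by
            rw [hNc, div_rpow hX0.le (by norm_num)]; field_simp
        _ ≤ |θ| * (|(q : ℝ) ^ c - (p : ℝ) ^ c| * M ^ c) := by gcongr
        _ = _ := by rw [abs_mul]; ring
    · calc |θ * ((q : ℝ) ^ c - (p : ℝ) ^ c)| * M ^ c
          = |θ| * (|(q : ℝ) ^ c - (p : ℝ) ^ c| * M ^ c) := by rw [abs_mul]; ring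
        _ ≤ X ^ (0.0436 : ℝ) * ((c * (4 * N) ^ (c - 1) * Q) * M ^ c) := by gcongr
        _ = X ^ (0.0436 : ℝ) * (c * ((4 * N) ^ (c - 1) * M ^ c) * Q) := by ring
        _ = X ^ (0.0436 : ℝ) * (c * (2 ^ (c - 1) * X ^ (c - 1) * M) * Q) := by
            rw [hNc', mul_rpow (by norm_num) hX0.le]
        _ ≤ X ^ (0.0436 : ℝ) * (3 * (4 * X ^ (c - 1) * M) * (2 * Y)) := by
            gcongr
            linarith
        _ = 24 * (X ^ (0.0436 : ℝ) * X ^ (c - 1) * X ^ (0.02904 : ℝ)) * M := by ring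
        _ ≤ X ^ (0.0007 : ℝ) * (X ^ (0.0436 : ℝ) * X ^ (c - 1) * X ^ (0.02904 : ℝ)) * M := by
            gcongr
        _ = X ^ (0.0007 + (0.0436 + (c - 1) + 0.02904) : ℝ) * M := by
            rw [rpow_add hX0, rpow_add hX0 (0.0436 + (c - 1)), rpow_add hX0 0.0436]
        _ ≤ X ^ (0.4999 * (4 : ℕ) + (-0.8712) : ℝ) * M := by
            refine mul_le_mul_of_nonneg_right (rpow_le_rpow_of_exponent_le hX.le ?_) hM0.le
            push_cast; linarith
        _ = (X ^ (0.4999 : ℝ)) ^ 4 * X ^ (-0.8712 : ℝ) * M := by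
            rw [rpow_add hX0, rpow_mul_natCast hX0.le]
        _ ≤ M ^ 4 * X ^ (-0.8712 : ℝ) * M := by gcongr
        _ = _ := by ring
    · intro x hx y hy z hxz hzy
      simp only [hS, mem_filter] at hx hy ⊢
      have hxz' : (x : ℝ) ≤ z := by exact_mod_cast hxz
      have hzy' : (z : ℝ) ≤ y := by exact_mod_cast hzy
      refine ⟨hconv x hx.1 y hy.1 z hxz hzy, ⟨hx.2.1.1.trans_le ?_, le_trans ?_ hy.2.1.2⟩,
        hx.2.2.1.trans_le ?_, le_trans ?_ hy.2.2.2⟩ <;> gcongr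
    · intro x hx
      exact hs x (mem_of_mem_filter x hx)

lemma sum_Ioc_sum_divisorsAntidiagonal {E : Type*} [AddCommMonoid E] (a b : ℕ) (F : ℕ → ℕ → E) :
    ∑ n ∈ Ioc a b, ∑ p ∈ n.divisorsAntidiagonal, F p.1 p.2 =
      ∑ d ∈ Ioc 0 b, ∑ k ∈ Ioc 0 b, if a < d * k ∧ d * k ≤ b then F d k else 0 := by
  rw [← sum_product', ← sum_filter]
  have hmaps : ∀ p ∈ (Ioc 0 b ×ˢ Ioc 0 b).filter (fun p : ℕ × ℕ => a < p.1 * p.2 ∧ p.1 * p.2 ≤ b),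
      p.1 * p.2 ∈ Ioc a b := fun p hp => by
    simp only [mem_filter] at hp
    exact mem_Ioc.2 hp.2
  rw [← sum_fiberwise_of_maps_to hmaps]
  refine sum_congr rfl fun n hn => sum_congr ?_ fun _ _ => rfl
  rw [mem_Ioc] at hn
  ext ⟨d, k⟩
  simp only [Nat.mem_divisorsAntidiagonal, mem_filter, mem_product, mem_Ioc]
  constructor
  · rintro ⟨rfl, h0⟩
    have hd : 0 < d := Nat.pos_of_ne_zero (left_ne_zero_of_mul h0)
    have hk : 0 < k := Nat.pos_of_ne_zero (right_ne_zero_of_mul h0)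
    exact ⟨⟨⟨⟨hd, (Nat.le_mul_of_pos_right d hk).trans hn.2⟩, hk,
      (Nat.le_mul_of_pos_left k hd).trans hn.2⟩, hn⟩, rfl⟩
  · rintro ⟨_, rfl⟩
    exact ⟨rfl, by omega⟩

lemma sum_inv_Ioc_le (H : ℕ) : ∑ d ∈ Ioc 0 H, (d : ℝ)⁻¹ ≤ 1 + Real.log H := by
  have := harmonic_le_one_add_log H
  rw [harmonic_eq_sum_Icc] at this
  push_cast at this
  exact this

lemma card_divisors_mul_le (d k : ℕ) :
    #(d * k).divisors ≤ #d.divisors * #k.divisors := by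
  rw [Nat.divisors_mul]
  exact card_mul_le

lemma sum_Ioc_sum_divisorsAntidiagonal_le (H : ℕ) {F : ℕ → ℕ → ℝ} (hF : ∀ d k, 0 ≤ F d k) :
    ∑ n ∈ Ioc 0 H, ∑ p ∈ n.divisorsAntidiagonal, F p.1 p.2 ≤
      ∑ d ∈ Ioc 0 H, ∑ k ∈ Ioc 0 H, F d k := by
  rw [sum_Ioc_sum_divisorsAntidiagonal]
  gcongr
  split_ifs
  · exact le_rfl
  · exact hF _ _

lemma sum_card_divisors_div_le (H : ℕ) :
    ∑ m ∈ Ioc 0 H, (#m.divisors : ℝ) / m ≤ (1 + Real.log H) ^ 2 := by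
  calc ∑ m ∈ Ioc 0 H, (#m.divisors : ℝ) / m
      = ∑ m ∈ Ioc 0 H, ∑ p ∈ m.divisorsAntidiagonal, (p.1 : ℝ)⁻¹ * (p.2 : ℝ)⁻¹ := by
        refine sum_congr rfl fun m _ => ?_
        rw [Nat.sum_divisorsAntidiagonal (fun d k => (d : ℝ)⁻¹ * (k : ℝ)⁻¹), div_eq_mul_inv,
          ← nsmul_eq_mul, ← sum_const]
        refine sum_congr rfl fun d hd => ?_
        rw [← mul_inv]
        congr 1
        have := Nat.mul_div_cancel' (Nat.dvd_of_mem_divisors hd)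
        exact_mod_cast this.symm
    _ ≤ ∑ d ∈ Ioc 0 H, ∑ k ∈ Ioc 0 H, (d : ℝ)⁻¹ * (k : ℝ)⁻¹ :=
        sum_Ioc_sum_divisorsAntidiagonal_le H (F := fun d k => (d : ℝ)⁻¹ * (k : ℝ)⁻¹)
          (fun _ _ => by positivity)
    _ = (∑ d ∈ Ioc 0 H, (d : ℝ)⁻¹) ^ 2 := by rw [sq, sum_mul_sum]
    _ ≤ _ := by
        gcongr
        exact sum_inv_Ioc_le H

lemma sum_card_divisors_sq_le (H : ℕ) :
    ∑ m ∈ Ioc 0 H, (#m.divisors : ℝ) ^ 2 ≤ H * (1 + Real.log H) ^ 4 := by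
  calc ∑ m ∈ Ioc 0 H, (#m.divisors : ℝ) ^ 2
      ≤ ∑ m ∈ Ioc 0 H, H * ∑ p ∈ m.divisorsAntidiagonal,
          (#p.1.divisors : ℝ) / p.1 * ((#p.2.divisors : ℝ) / p.2) := by
        refine sum_le_sum fun m hm => ?_
        rw [mem_Ioc] at hm
        have hm0 : (0 : ℝ) < m := by exact_mod_cast hm.1
        rw [Nat.sum_divisorsAntidiagonal
          (fun d k => (#d.divisors : ℝ) / d * ((#k.divisors : ℝ) / k))]
        have : ∀ d ∈ m.divisors, (#m.divisors : ℝ) / m ≤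
            (#d.divisors : ℝ) / d * ((#(m / d).divisors : ℝ) / (m / d : ℕ)) := fun d hd => by
          have h1 := Nat.mul_div_cancel' (Nat.dvd_of_mem_divisors hd)
          have h2 := card_divisors_mul_le d (m / d)
          rw [h1] at h2
          rw [div_mul_div_comm]
          have h3 : (d : ℝ) * (m / d : ℕ) = m := by exact_mod_cast h1
          rw [h3]
          gcongr
          exact_mod_cast h2
        calc (#m.divisors : ℝ) ^ 2 = m * ∑ d ∈ m.divisors, (#m.divisors : ℝ) / m := by
              rw [sum_const, nsmul_eq_mul]; field_simp
          _ ≤ H * ∑ d ∈ m.divisors,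
              (#d.divisors : ℝ) / d * ((#(m / d).divisors : ℝ) / (m / d : ℕ)) := by
              gcongr with d hd
              · exact hm.2
              · exact this d hd
    _ ≤ H * ∑ d ∈ Ioc 0 H, ∑ k ∈ Ioc 0 H, (#d.divisors : ℝ) / d * ((#k.divisors : ℝ) / k) := by
        rw [← mul_sum]
        refine mul_le_mul_of_nonneg_left ?_ (Nat.cast_nonneg H)
        exact sum_Ioc_sum_divisorsAntidiagonal_le H
          (F := fun d k => (#d.divisors : ℝ) / d * ((#k.divisors : ℝ) / k))
          (fun _ _ => by positivity)
    _ = H * (∑ d ∈ Ioc 0 H, (#d.divisors : ℝ) / d) ^ 2 := by rw [sq, sum_mul_sum]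
    _ ≤ H * ((1 + Real.log H) ^ 2) ^ 2 := by
        have := sum_card_divisors_div_le H
        gcongr
    _ = _ := by ring

/-- Partial summation against a monotone weight. -/
lemma norm_sum_mul_le_of_monotone {g : ℕ → ℝ} (hg : Monotone g) (hg0 : g 0 = 0) {S : Finset ℕ}
    {H : ℕ} (hS : ∀ n ∈ S, n ≤ H) {z : ℕ → ℂ} {T : ℝ}
    (hT : ∀ j, ‖∑ n ∈ S with j < n, z n‖ ≤ T) : ‖∑ n ∈ S, (g n : ℂ) * z n‖ ≤ g H * T := by
  have e : ∑ n ∈ S, (g n : ℂ) * z n =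
      ∑ j ∈ range H, ((g (j + 1) - g j : ℝ) : ℂ) * ∑ n ∈ S with j < n, z n := by
    have : ∀ n ∈ S, (g n : ℂ) * z n =
        ∑ j ∈ range H, if j < n then ((g (j + 1) - g j : ℝ) : ℂ) * z n else 0 := fun n hn => by
      rw [← sum_filter, ← sum_mul, ← Complex.ofReal_sum]
      have h1 : {j ∈ range H | j < n} = range n := by
        ext j
        have := hS n hn
        simp only [mem_filter, mem_range]
        omega
      rw [h1, sum_range_sub, hg0, sub_zero]
    rw [sum_congr rfl this, sum_comm]
    refine sum_congr rfl fun j _ => ?_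
    rw [mul_sum, sum_filter]
  rw [e]
  have hpos : ∀ j, 0 ≤ g (j + 1) - g j := fun j => sub_nonneg.2 (hg (Nat.le_succ j))
  calc _ ≤ ∑ j ∈ range H, (g (j + 1) - g j) * T := by
        refine (norm_sum_le _ _).trans (sum_le_sum fun j _ => ?_)
        rw [norm_mul, Complex.norm_real, Real.norm_of_nonneg (hpos j)]
        exact mul_le_mul_of_nonneg_left (hT j) (hpos j)
    _ = _ := by rw [← sum_mul, sum_range_sub, hg0, sub_zero]

/-- The truncation of an arithmetic function to arguments at most `V`. -/
noncomputable def truncLE (V : ℝ) (f : ArithmeticFunction ℝ) : ArithmeticFunction ℝ :=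
  ⟨fun n => if (n : ℝ) ≤ V then f n else 0, by simp⟩

lemma truncLE_apply (V : ℝ) (f : ArithmeticFunction ℝ) (n : ℕ) :
    truncLE V f n = if (n : ℝ) ≤ V then f n else 0 := rfl

lemma sub_truncLE_apply (V : ℝ) (f : ArithmeticFunction ℝ) (n : ℕ) :
    (f - truncLE V f) n = if (n : ℝ) ≤ V then 0 else f n := by
  have : (f - truncLE V f) n = f n - truncLE V f n := by
    rw [sub_eq_add_neg, sub_eq_add_neg]; rfl
  rw [this, truncLE_apply]
  split_ifs <;> simp

/-- Vaughan's identity. -/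
lemma vaughan_identity (V : ℝ) :
    vonMangoldt - truncLE V vonMangoldt = truncLE V (moebius : ArithmeticFunction ℝ) * ArithmeticFunction.log -
      truncLE V (moebius : ArithmeticFunction ℝ) * truncLE V vonMangoldt * (zeta : ArithmeticFunction ℝ) +
      (((moebius : ArithmeticFunction ℝ) - truncLE V (moebius : ArithmeticFunction ℝ)) *
        (zeta : ArithmeticFunction ℝ)) * (vonMangoldt - truncLE V vonMangoldt) := by
  have h1 : (moebius : ArithmeticFunction ℝ) * (zeta : ArithmeticFunction ℝ) = 1 :=
    coe_moebius_mul_coe_zeta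
  have h2 : vonMangoldt * (zeta : ArithmeticFunction ℝ) = ArithmeticFunction.log := vonMangoldt_mul_zeta
  rw [← h2]
  linear_combination (truncLE V vonMangoldt - vonMangoldt) * h1

/-- The function `n ↦ e(θ n ^ c)` on the interval `(X, 2 * X]`, extended by zero. -/
noncomputable def dyadicPhase (c θ X : ℝ) (n : ℕ) : ℂ :=
  if X < n ∧ (n : ℝ) ≤ 2 * X then eC (θ * (n : ℝ) ^ c) else 0

lemma sum_Ioc_mul_dyadicPhase {c θ X : ℝ} (hX : 0 ≤ X) (f : ℕ → ℂ) :
    ∑ n ∈ Ioc 0 ⌊2 * X⌋₊, f n * dyadicPhase c θ X n =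
      ∑ n ∈ Ioc ⌊X⌋₊ ⌊2 * X⌋₊, f n * eC (θ * (n : ℝ) ^ c) := by
  have : Ioc ⌊X⌋₊ ⌊2 * X⌋₊ = (Ioc 0 ⌊2 * X⌋₊).filter fun n : ℕ => X < n ∧ (n : ℝ) ≤ 2 * X := by
    ext n
    simp only [mem_filter, mem_Ioc]
    rw [Nat.floor_lt hX, Nat.le_floor_iff (by positivity)]
    constructor
    · rintro ⟨h1, h2⟩
      exact ⟨⟨by exact_mod_cast hX.trans_lt h1, h2⟩, h1, h2⟩
    · rintro ⟨_, h⟩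
      exact h
  rw [this, sum_filter]
  refine sum_congr rfl fun n _ => ?_
  rw [dyadicPhase]
  split_ifs <;> simp

lemma sum_mul_dyadicPhase {c θ X : ℝ} (f g : ArithmeticFunction ℝ) :
    ∑ n ∈ Ioc 0 ⌊2 * X⌋₊, ((f * g) n : ℂ) * dyadicPhase c θ X n =
      ∑ d ∈ Ioc 0 ⌊2 * X⌋₊, ∑ k ∈ Ioc 0 ⌊2 * X⌋₊,
        (f d : ℂ) * (g k : ℂ) * dyadicPhase c θ X (d * k) := by
  have e : ∀ n, ((f * g) n : ℂ) * dyadicPhase c θ X n = ∑ p ∈ n.divisorsAntidiagonal,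
      (f p.1 : ℂ) * (g p.2 : ℂ) * dyadicPhase c θ X (p.1 * p.2) := fun n => by
    rw [ArithmeticFunction.mul_apply]
    push_cast
    rw [sum_mul]
    refine sum_congr rfl fun p hp => ?_
    rw [(Nat.mem_divisorsAntidiagonal.1 hp).1]
  rw [sum_congr rfl fun n _ => e n, sum_Ioc_sum_divisorsAntidiagonal 0 ⌊2 * X⌋₊
    (fun d k => (f d : ℂ) * (g k : ℂ) * dyadicPhase c θ X (d * k))]
  refine sum_congr rfl fun d hd => sum_congr rfl fun k hk => ?_
  rw [mem_Ioc] at hd hk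
  split_ifs with h
  · rfl
  · have : ¬ (X < (d * k : ℕ) ∧ ((d * k : ℕ) : ℝ) ≤ 2 * X) := fun h2 =>
      h ⟨Nat.mul_pos hd.1 hk.1, Nat.le_floor h2.2⟩
    rw [dyadicPhase, if_neg this, mul_zero]

lemma exists_typeI_le {c : ℝ} (hc1 : 1 < c) (hc2 : c < 4109054 / 1999527) (hc3 : c ≠ 2) :
    ∃ C : ℝ, 0 < C ∧ ∀ᶠ X : ℝ in Filter.atTop, ∀ θ : ℝ, X ^ (0.93 : ℝ) ≤ |θ| * X ^ c →
      |θ| ≤ X ^ (0.0436 : ℝ) → ∀ (f g : ℕ → ℝ) (L : ℝ), Monotone g → g 0 = 0 →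
      (∀ d : ℕ, X ^ (0.1 : ℝ) < d → f d = 0) → (∀ d ∈ Ioc 0 ⌊2 * X⌋₊, |f d| ≤ L) →
      ‖∑ d ∈ Ioc 0 ⌊2 * X⌋₊, ∑ k ∈ Ioc 0 ⌊2 * X⌋₊,
        (f d : ℂ) * (g k : ℂ) * dyadicPhase c θ X (d * k)‖ ≤
        C * X ^ (1 - 0.02904 : ℝ) * (L * g ⌊2 * X⌋₊ * (1 + Real.log ⌊2 * X⌋₊)) := by
  obtain ⟨C, hC, H⟩ := exists_norm_sum_rpow_le_of_convex hc1 (by linarith) hc3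
  refine ⟨C, hC, ?_⟩
  filter_upwards [Filter.eventually_gt_atTop 1] with X hX
  intro θ hθ1 hθ2 f g L hg hg0 hf hL
  have hX0 : 0 < X := by linarith
  set K := ⌊2 * X⌋₊ with hK
  have hgK : 0 ≤ g K := hg0 ▸ hg (Nat.zero_le K)
  have hL0 : 0 ≤ L := (abs_nonneg _).trans (hL 1 (by
    rw [mem_Ioc]; exact ⟨one_pos, Nat.le_floor (by push_cast; linarith)⟩))
  have key : ∀ d ∈ Ioc 0 K, ‖∑ k ∈ Ioc 0 K, (f d : ℂ) * (g k : ℂ) * dyadicPhase c θ X (d * k)‖ ≤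
      L * (g K * (C * (X * X ^ (-0.02904 : ℝ)))) * (d : ℝ)⁻¹ := by
    intro d hd
    have hd0 : (0 : ℝ) < d := by exact_mod_cast (mem_Ioc.1 hd).1
    rcases lt_or_ge (X ^ (0.1 : ℝ)) d with hdX | hdX
    · simp only [hf d hdX, Complex.ofReal_zero, zero_mul, sum_const_zero, norm_zero]
      positivity
    set S := (Ioc 0 K).filter fun k : ℕ => X < d * k ∧ (d * k : ℝ) ≤ 2 * X with hS
    have e : ∑ k ∈ Ioc 0 K, (f d : ℂ) * (g k : ℂ) * dyadicPhase c θ X (d * k) =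
        f d * ∑ k ∈ S, (g k : ℂ) * eC (θ * (d : ℝ) ^ c * (k : ℝ) ^ c) := by
      rw [mul_sum, hS, sum_filter]
      refine sum_congr rfl fun k _ => ?_
      rw [dyadicPhase]
      push_cast
      split_ifs
      · rw [mul_rpow hd0.le (Nat.cast_nonneg k)]
        ring_nf
      · simp
    have hM : X ^ (0.9 : ℝ) ≤ X / d := by
      rw [le_div_iff₀ hd0]
      calc X ^ (0.9 : ℝ) * d ≤ X ^ (0.9 : ℝ) * X ^ (0.1 : ℝ) := by gcongr
        _ = X := by rw [← rpow_add hX0]; norm_num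
    have hB : |θ * (d : ℝ) ^ c| * (X / d) ^ c = |θ| * X ^ c := by
      rw [div_rpow hX0.le hd0.le, abs_mul, abs_of_pos (rpow_pos_of_pos hd0 c)]
      field_simp
    have hT : ∀ j, ‖∑ k ∈ S with j < k, eC (θ * (d : ℝ) ^ c * (k : ℝ) ^ c)‖ ≤
        C * (X / d * X ^ (-0.02904 : ℝ)) := by
      intro j
      refine H X (X / d) _ _ hX ((one_le_rpow hX.le (by norm_num)).trans hM)
        ((rpow_le_rpow_of_exponent_le hX.le (by norm_num)).trans hM) ?_ ?_ ?_ ?_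
      · rw [hB]
        exact (rpow_le_rpow_of_exponent_le hX.le (by norm_num)).trans hθ1
      · rw [hB]
        calc |θ| * X ^ c ≤ X ^ (0.0436 : ℝ) * X ^ c := by gcongr
          _ = X ^ (0.0436 + c) := by rw [rpow_add hX0]
          _ ≤ X ^ (0.9 * (5 : ℕ) + (-0.8712) : ℝ) :=
              rpow_le_rpow_of_exponent_le hX.le (by push_cast; linarith)
          _ = (X ^ (0.9 : ℝ)) ^ 5 * X ^ (-0.8712 : ℝ) := by
              rw [rpow_add hX0, rpow_mul_natCast hX0.le]
          _ ≤ _ := by gcongr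
      · intro x hx y hy z hxz hzy
        simp only [hS, mem_filter, mem_Ioc] at hx hy ⊢
        have hxz' : (x : ℝ) ≤ z := by exact_mod_cast hxz
        have hzy' : (z : ℝ) ≤ y := by exact_mod_cast hzy
        refine ⟨⟨by omega, hx.1.2.1.trans_le ?_, le_trans ?_ hy.1.2.2⟩, by omega⟩ <;> gcongr
      · intro x hx
        simp only [hS, mem_filter] at hx
        rw [div_le_iff₀ hd0, ← mul_div_assoc, le_div_iff₀ hd0]
        constructor <;> linarith [hx.1.2.1, hx.1.2.2]
    have h1 := norm_sum_mul_le_of_monotone hg hg0 (S := S) (H := K)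
      (fun n hn => (mem_Ioc.1 (mem_of_mem_filter n hn)).2) hT
    rw [e, norm_mul, Complex.norm_real, Real.norm_eq_abs]
    calc _ ≤ L * (g K * (C * (X / d * X ^ (-0.02904 : ℝ)))) :=
          mul_le_mul (hL d hd) h1 (norm_nonneg _) hL0
      _ = _ := by ring
  refine (norm_sum_le _ _).trans ((sum_le_sum key).trans ?_)
  rw [← mul_sum]
  have h1 := sum_inv_Ioc_le K
  have h2 : X ^ (1 - 0.02904 : ℝ) = X * X ^ (-0.02904 : ℝ) := by
    rw [sub_eq_add_neg, rpow_add hX0, rpow_one]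
  rw [h2]
  calc _ ≤ L * (g K * (C * (X * X ^ (-0.02904 : ℝ)))) * (1 + Real.log K) := by gcongr
    _ = _ := by ring

lemma exists_typeII_block_le {c : ℝ} (hc1 : 1 < c) (hc2 : c < 4109054 / 1999527) (hc3 : c ≠ 2) :
    ∃ C : ℝ, 0 < C ∧ ∀ᶠ X : ℝ in Filter.atTop, ∀ θ : ℝ, X ^ (0.93 : ℝ) ≤ |θ| * X ^ c →
      |θ| ≤ X ^ (0.0436 : ℝ) → ∀ (a b : ℕ → ℝ) (ℓ : ℝ), 0 ≤ ℓ →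
      (∀ m : ℕ, (m : ℝ) ≤ X ^ (0.05 : ℝ) → a m = 0) →
      (∀ n : ℕ, (n : ℝ) ≤ X ^ (0.05 : ℝ) → b n = 0) →
      (∀ m, |a m| ≤ #m.divisors) → (∀ n ∈ Ioc 0 ⌊2 * X⌋₊, |b n| ≤ ℓ) → ∀ i : ℕ,
      ‖∑ m ∈ Ioc 0 ⌊2 * X⌋₊ with Nat.log 2 m = i, ∑ n ∈ Ioc 0 ⌊2 * X⌋₊,
        (a m : ℂ) * (b n : ℂ) * dyadicPhase c θ X (m * n)‖ ^ 2 ≤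
        C * X ^ (1 - 0.02904 : ℝ) * (4 * X * ((1 + Real.log ⌊2 * X⌋₊) ^ 4 * ℓ ^ 2)) := by
  obtain ⟨C, hC, H⟩ := exists_bilinear_rpow_le hc1 hc2 hc3
  refine ⟨C, hC, ?_⟩
  have ev1 := (tendsto_rpow_atTop (show (0:ℝ) < 0.01 by norm_num)).eventually_ge_atTop 4
  have ev2 := (tendsto_rpow_atTop (show (0:ℝ) < 0.0001 by norm_num)).eventually_ge_atTop 2
  filter_upwards [H, ev1, ev2, Filter.eventually_gt_atTop 1] with X hbil e1 e2 hX
  intro θ hθ1 hθ2 a b ℓ hℓ ha hb hadiv hbℓ i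
  have hX0 : 0 < X := by linarith
  set K := ⌊2 * X⌋₊ with hK
  have hK1 : 1 ≤ K := Nat.le_floor (by push_cast; linarith)
  have hlogK : 0 ≤ Real.log K := Real.log_natCast_nonneg K
  set s := (Ioc 0 K).filter fun m => Nat.log 2 m = i with hs
  set t := (Ioc 0 K).filter fun n : ℕ => X / 2 ^ (i + 1) ≤ n ∧ (n : ℝ) ≤ 2 * X / 2 ^ i with ht
  have hpow : (0 : ℝ) < 2 ^ i := by positivity
  have hsm : ∀ m ∈ s, (2 : ℝ) ^ i ≤ m ∧ (m : ℝ) ≤ 2 * 2 ^ i := fun m hm => by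
    simp only [hs, mem_filter, mem_Ioc] at hm
    have h1 := Nat.pow_log_le_self 2 (x := m) (by omega)
    have h2 := Nat.lt_pow_succ_log_self (b := 2) (by norm_num) m
    rw [hm.2] at h1 h2
    constructor
    · exact_mod_cast h1
    · rw [pow_succ] at h2
      have : m ≤ 2 * 2 ^ i := by omega
      exact_mod_cast this
  have htn : ∀ n ∈ t, X / 2 ^ (i + 1) ≤ n ∧ (n : ℝ) ≤ 4 * (X / 2 ^ (i + 1)) := fun n hn => by
    simp only [ht, mem_filter] at hn
    refine ⟨hn.2.1, hn.2.2.trans (le_of_eq ?_)⟩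
    rw [pow_succ]; field_simp; norm_num
  have hred : ∑ m ∈ s, ∑ n ∈ Ioc 0 K, (a m : ℂ) * (b n : ℂ) * dyadicPhase c θ X (m * n) =
      ∑ m ∈ s, ∑ n ∈ t, (a m : ℂ) * (b n : ℂ) * dyadicPhase c θ X (m * n) := by
    refine sum_congr rfl fun m hm => (sum_subset (filter_subset _ _) fun n hn hnt => ?_).symm
    have : ¬ (X < (m * n : ℕ) ∧ ((m * n : ℕ) : ℝ) ≤ 2 * X) := by
      push_cast
      rintro ⟨h1, h2⟩
      refine hnt (mem_filter.2 ⟨hn, ?_⟩)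
      obtain ⟨h3, h4⟩ := hsm m hm
      constructor
      · rw [div_le_iff₀ (by positivity), pow_succ]
        have : (m : ℝ) * n ≤ 2 * 2 ^ i * n := by gcongr
        linarith
      · rw [le_div_iff₀ hpow]
        have : (2 : ℝ) ^ i * n ≤ m * n := by gcongr
        linarith
    rw [dyadicPhase, if_neg this, mul_zero]
  rw [hred]
  have ha2 : ∑ m ∈ s, ‖(a m : ℂ)‖ ^ 2 ≤ 2 * 2 ^ i * (1 + Real.log K) ^ 4 := by
    set K' := min K (2 * 2 ^ i) with hK'
    have hsub : s ⊆ Ioc 0 K' := fun m hm => by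
      have h1 := (hsm m hm).2
      have h2 := mem_Ioc.1 (mem_of_mem_filter m hm)
      have h3 : m ≤ 2 * 2 ^ i := by exact_mod_cast h1
      rw [mem_Ioc]; omega
    have hK0 : 0 < K' := lt_min hK1 (by positivity)
    have hKK : (K' : ℝ) ≤ K := by exact_mod_cast min_le_left _ _
    have hKi : (K' : ℝ) ≤ 2 * 2 ^ i := by exact_mod_cast min_le_right K (2 * 2 ^ i)
    have hK0' : (0 : ℝ) < K' := by exact_mod_cast hK0
    have hlog0 := Real.log_natCast_nonneg K'
    calc ∑ m ∈ s, ‖(a m : ℂ)‖ ^ 2 ≤ ∑ m ∈ s, (#m.divisors : ℝ) ^ 2 := by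
          gcongr with m _
          rw [Complex.norm_real]
          exact hadiv m
      _ ≤ ∑ m ∈ Ioc 0 K', (#m.divisors : ℝ) ^ 2 :=
          sum_le_sum_of_subset_of_nonneg hsub fun _ _ _ => by positivity
      _ ≤ K' * (1 + Real.log K') ^ 4 := sum_card_divisors_sq_le K'
      _ ≤ _ := by gcongr
  have hb2 : ∑ n ∈ t, ‖(b n : ℂ)‖ ^ 2 ≤ 2 * X / 2 ^ i * ℓ ^ 2 := by
    have hsub : t ⊆ Ioc 0 ⌊2 * X / 2 ^ i⌋₊ := fun n hn => by
      simp only [ht, mem_filter, mem_Ioc] at hn ⊢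
      exact ⟨hn.1.1, Nat.le_floor hn.2.2⟩
    have hcard : (#t : ℝ) ≤ 2 * X / 2 ^ i := by
      have := card_le_card hsub
      rw [Nat.card_Ioc, tsub_zero] at this
      calc (#t : ℝ) ≤ (⌊2 * X / 2 ^ i⌋₊ : ℝ) := by exact_mod_cast this
        _ ≤ _ := Nat.floor_le (by positivity)
    calc ∑ n ∈ t, ‖(b n : ℂ)‖ ^ 2 ≤ ∑ n ∈ t, ℓ ^ 2 := by
          gcongr with n hn
          rw [Complex.norm_real]
          exact hbℓ n (mem_of_mem_filter n hn)
      _ = #t * ℓ ^ 2 := by rw [sum_const, nsmul_eq_mul]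
      _ ≤ _ := by gcongr
  have hprod : (∑ m ∈ s, ‖(a m : ℂ)‖ ^ 2) * ∑ n ∈ t, ‖(b n : ℂ)‖ ^ 2 ≤
      4 * X * ((1 + Real.log K) ^ 4 * ℓ ^ 2) := by
    calc _ ≤ (2 * 2 ^ i * (1 + Real.log K) ^ 4) * (2 * X / 2 ^ i * ℓ ^ 2) := by
          gcongr
      _ = _ := by field_simp; ring
  have hzero : 0 ≤ C * X ^ (1 - 0.02904 : ℝ) * (4 * X * ((1 + Real.log K) ^ 4 * ℓ ^ 2)) := by
    positivity
  have hsmall : 4 * X ^ (0.04 : ℝ) ≤ X ^ (0.05 : ℝ) := by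
    calc 4 * X ^ (0.04 : ℝ) ≤ X ^ (0.01 : ℝ) * X ^ (0.04 : ℝ) := by gcongr
      _ = X ^ (0.05 : ℝ) := by rw [← rpow_add hX0]; norm_num
  rcases le_or_gt (X ^ (0.5 : ℝ)) (2 ^ i) with hi | hi
  · rcases lt_or_ge (X / 2 ^ (i + 1)) (X ^ (0.04 : ℝ)) with hN | hN
    · rw [sum_eq_zero fun m _ => sum_eq_zero fun n hn => ?_]
      · simpa using hzero
      · rw [hb n (by linarith [(htn n hn).2])]
        simp
    · have hsconv : ∀ x ∈ s, ∀ y ∈ s, ∀ z, x ≤ z → z ≤ y → z ∈ s := by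
        intro x hx y hy z hxz hzy
        simp only [hs, mem_filter, mem_Ioc] at hx hy ⊢
        have h1 : Nat.log 2 x ≤ Nat.log 2 z := Nat.log_mono_right hxz
        have h2 : Nat.log 2 z ≤ Nat.log 2 y := Nat.log_mono_right hzy
        omega
      have := hbil θ (2 ^ i) (X / 2 ^ (i + 1)) hθ1 hθ2 (by rw [pow_succ]; field_simp)
        ((rpow_le_rpow_of_exponent_le hX.le (by norm_num)).trans hi) hN s t
        (fun m => (a m : ℂ)) (fun n => (b n : ℂ))
        (fun m hm => ⟨(hsm m hm).1, by linarith [(hsm m hm).2]⟩) htn hsconv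
      simp only [dyadicPhase, Nat.cast_mul]
      refine this.trans ?_
      rw [mul_assoc (C * _)]
      gcongr
  · rcases lt_or_ge ((2 : ℝ) ^ i) (X ^ (0.04 : ℝ)) with hN | hN
    · rw [sum_eq_zero fun m hm => sum_eq_zero fun n _ => ?_]
      · simpa using hzero
      · rw [ha m (by linarith [(hsm m hm).2])]
        simp
    · have htconv : ∀ x ∈ t, ∀ y ∈ t, ∀ z, x ≤ z → z ≤ y → z ∈ t := by
        intro x hx y hy z hxz hzy
        simp only [ht, mem_filter, mem_Ioc] at hx hy ⊢
        have hxz' : (x : ℝ) ≤ z := by exact_mod_cast hxz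
        have hzy' : (z : ℝ) ≤ y := by exact_mod_cast hzy
        exact ⟨by omega, hx.2.1.trans hxz', hzy'.trans hy.2.2⟩
      have hM : X ^ (0.4999 : ℝ) ≤ X / 2 ^ (i + 1) := by
        rw [le_div_iff₀ (by positivity), pow_succ]
        calc X ^ (0.4999 : ℝ) * (2 ^ i * 2) ≤ X ^ (0.4999 : ℝ) * (X ^ (0.5 : ℝ) * X ^ (0.0001 : ℝ)) := by
              gcongr
          _ = X := by
              rw [← rpow_add hX0, ← rpow_add hX0]; norm_num
      have := hbil θ (X / 2 ^ (i + 1)) (2 ^ i) hθ1 hθ2 (by rw [pow_succ]; field_simp)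
        hM hN t s (fun n => (b n : ℂ)) (fun m => (a m : ℂ)) htn
        (fun m hm => ⟨(hsm m hm).1, by linarith [(hsm m hm).2]⟩) htconv
      rw [sum_comm]
      have e : ∀ m n : ℕ, (a m : ℂ) * (b n : ℂ) * dyadicPhase c θ X (m * n) = (b n : ℂ) * (a m : ℂ) *
          (if X < (n : ℝ) * m ∧ (n * m : ℝ) ≤ 2 * X then eC (θ * (n * m : ℝ) ^ c) else 0) := by
        intro m n
        rw [dyadicPhase, Nat.cast_mul, mul_comm (m : ℝ), mul_comm (a m : ℂ)]
      simp only [e]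
      refine this.trans ?_
      rw [mul_assoc (C * _), mul_comm (∑ n ∈ t, _)]
      gcongr

lemma exists_typeII_le {c : ℝ} (hc1 : 1 < c) (hc2 : c < 4109054 / 1999527) (hc3 : c ≠ 2) :
    ∃ C : ℝ, 0 < C ∧ ∀ᶠ X : ℝ in Filter.atTop, ∀ θ : ℝ, X ^ (0.93 : ℝ) ≤ |θ| * X ^ c →
      |θ| ≤ X ^ (0.0436 : ℝ) → ∀ (a b : ℕ → ℝ),
      (∀ m : ℕ, (m : ℝ) ≤ X ^ (0.05 : ℝ) → a m = 0) →
      (∀ n : ℕ, (n : ℝ) ≤ X ^ (0.05 : ℝ) → b n = 0) →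
      (∀ m, |a m| ≤ #m.divisors) →
      (∀ n ∈ Ioc 0 ⌊2 * X⌋₊, |b n| ≤ 1 + Real.log ⌊2 * X⌋₊) →
      ‖∑ m ∈ Ioc 0 ⌊2 * X⌋₊, ∑ n ∈ Ioc 0 ⌊2 * X⌋₊,
        (a m : ℂ) * (b n : ℂ) * dyadicPhase c θ X (m * n)‖ ≤
        C * X ^ (1 - 0.01452 : ℝ) * (1 + Real.log ⌊2 * X⌋₊) ^ 4 := by
  obtain ⟨C, hC, H⟩ := exists_typeII_block_le hc1 hc2 hc3
  refine ⟨2 * √(4 * C), by positivity, ?_⟩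
  filter_upwards [H, Filter.eventually_gt_atTop 1] with X hbl hX
  intro θ hθ1 hθ2 a b ha hb hadiv hbl2
  have hX0 : 0 < X := by linarith
  set K := ⌊2 * X⌋₊ with hK
  have hK1 : 1 ≤ K := Nat.le_floor (by push_cast; linarith)
  have hlogK : 0 ≤ Real.log K := Real.log_natCast_nonneg K
  set ℓ := 1 + Real.log K with hℓ
  have hmaps : ∀ m ∈ Ioc 0 K, Nat.log 2 m ∈ range (Nat.log 2 K + 1) := fun m hm => by
    rw [mem_range]
    exact Nat.lt_succ_of_le (Nat.log_mono_right (mem_Ioc.1 hm).2)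
  rw [← sum_fiberwise_of_maps_to hmaps]
  have hblock : ∀ i, ‖∑ m ∈ Ioc 0 K with Nat.log 2 m = i, ∑ n ∈ Ioc 0 K,
      (a m : ℂ) * (b n : ℂ) * dyadicPhase c θ X (m * n)‖ ≤
      √(4 * C) * X ^ (1 - 0.01452 : ℝ) * ℓ ^ 3 := fun i => by
    refine (sq_le_sq₀ (norm_nonneg _) (by positivity)).1 ?_
    refine (hbl θ hθ1 hθ2 a b ℓ (by positivity) ha hb hadiv hbl2 i).trans (le_of_eq ?_)
    rw [mul_pow, mul_pow, sq_sqrt (by positivity), ← rpow_mul_natCast hX0.le]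
    have : X ^ ((1 - 0.01452) * (2 : ℕ) : ℝ) = X ^ (1 - 0.02904 : ℝ) * X := by
      rw [← rpow_add_one hX0.ne']
      congr 1
      push_cast
      norm_num
    rw [this]
    ring
  have hcount : ((Nat.log 2 K + 1 : ℕ) : ℝ) ≤ 2 * ℓ := by
    have h1 : (Nat.log 2 K : ℝ) ≤ Real.logb 2 K := by exact_mod_cast Real.natLog_le_logb K 2
    have h2 : Real.logb 2 K ≤ 2 * Real.log K := by
      rw [Real.logb, div_le_iff₀ (Real.log_pos (by norm_num))]
      have := Real.log_two_gt_d9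
      nlinarith
    push_cast
    rw [hℓ]
    linarith
  calc _ ≤ ∑ i ∈ range (Nat.log 2 K + 1), √(4 * C) * X ^ (1 - 0.01452 : ℝ) * ℓ ^ 3 :=
        (norm_sum_le _ _).trans (sum_le_sum fun i _ => hblock i)
    _ = (Nat.log 2 K + 1 : ℕ) * (√(4 * C) * X ^ (1 - 0.01452 : ℝ) * ℓ ^ 3) := by
        rw [sum_const, card_range, nsmul_eq_mul]
    _ ≤ 2 * ℓ * (√(4 * C) * X ^ (1 - 0.01452 : ℝ) * ℓ ^ 3) := by gcongr
    _ = _ := by ring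

lemma abs_moebius_mul_zeta_tail_le (V : ℝ) (m : ℕ) :
    |(((moebius : ArithmeticFunction ℝ) - truncLE V (moebius : ArithmeticFunction ℝ)) *
      (zeta : ArithmeticFunction ℝ)) m| ≤ #m.divisors := by
  rw [coe_mul_zeta_apply]
  refine (abs_sum_le_sum_abs _ _).trans ?_
  calc _ ≤ ∑ d ∈ m.divisors, (1 : ℝ) := by
        refine sum_le_sum fun d _ => ?_
        rw [sub_truncLE_apply]
        split_ifs
        · simp
        · rw [intCoe_apply]
          have := abs_moebius_le_one (n := d)
          exact_mod_cast this
    _ = _ := by simp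

lemma abs_truncLE_moebius_le (V : ℝ) (d : ℕ) :
    |truncLE V (moebius : ArithmeticFunction ℝ) d| ≤ 1 := by
  rw [truncLE_apply]
  split_ifs
  · rw [intCoe_apply]
    have := abs_moebius_le_one (n := d)
    exact_mod_cast this
  · simp

lemma abs_truncLE_vonMangoldt_le (V : ℝ) (d : ℕ) :
    |truncLE V vonMangoldt d| ≤ vonMangoldt d := by
  rw [truncLE_apply]
  split_ifs
  · rw [abs_of_nonneg vonMangoldt_nonneg]
  · simp

lemma abs_truncLE_mul_truncLE_le (V : ℝ) (d : ℕ) :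
    |(truncLE V (moebius : ArithmeticFunction ℝ) * truncLE V vonMangoldt) d| ≤ Real.log d := by
  rw [ArithmeticFunction.mul_apply]
  refine (abs_sum_le_sum_abs _ _).trans ?_
  calc _ ≤ ∑ p ∈ d.divisorsAntidiagonal, vonMangoldt p.2 := by
        refine sum_le_sum fun p _ => ?_
        rw [abs_mul]
        have h1 := abs_truncLE_moebius_le V p.1
        have h2 := abs_truncLE_vonMangoldt_le V p.2
        nlinarith [abs_nonneg (truncLE V vonMangoldt p.2),
          abs_nonneg (truncLE V (moebius : ArithmeticFunction ℝ) p.1)]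
    _ = Real.log d := by
        rw [Nat.sum_divisorsAntidiagonal' (fun _ k => vonMangoldt k), vonMangoldt_sum]

lemma exists_sum_vonMangoldt_le {c : ℝ} (hc1 : 1 < c) (hc2 : c < 4109054 / 1999527)
    (hc3 : c ≠ 2) :
    ∃ C : ℝ, 0 < C ∧ ∀ᶠ X : ℝ in Filter.atTop, ∀ θ : ℝ, X ^ (0.93 : ℝ) ≤ |θ| * X ^ c →
      |θ| ≤ X ^ (0.0436 : ℝ) →
      ‖∑ n ∈ Ioc ⌊X⌋₊ ⌊2 * X⌋₊, (vonMangoldt n : ℂ) * eC (θ * (n : ℝ) ^ c)‖ ≤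
        C * X ^ (1 - 0.01452 : ℝ) * (1 + Real.log ⌊2 * X⌋₊) ^ 4 := by
  obtain ⟨C₁, hC₁, H₁⟩ := exists_typeI_le hc1 hc2 hc3
  obtain ⟨C₂, hC₂, H₂⟩ := exists_typeII_le hc1 hc2 hc3
  refine ⟨C₁ + C₁ + C₂, by positivity, ?_⟩
  filter_upwards [H₁, H₂, Filter.eventually_gt_atTop 1] with X hI hII hX
  intro θ hθ1 hθ2
  have hX0 : 0 < X := by linarith
  rw [← sum_Ioc_mul_dyadicPhase hX0.le]
  set K := ⌊2 * X⌋₊ with hK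
  have hK1 : 1 ≤ K := Nat.le_floor (by push_cast; linarith)
  have hlogK : 0 ≤ Real.log K := Real.log_natCast_nonneg K
  set ℓ := 1 + Real.log K with hℓ
  have hℓ1 : 1 ≤ ℓ := by linarith
  set V := X ^ (0.05 : ℝ) with hV
  have hVX : V ≤ X := by
    calc V ≤ X ^ (1 : ℝ) := rpow_le_rpow_of_exponent_le hX.le (by norm_num)
      _ = X := rpow_one X
  have hVV : V * V = X ^ (0.1 : ℝ) := by rw [hV, ← rpow_add hX0]; norm_num
  have hV1 : 1 ≤ V := one_le_rpow hX.le (by norm_num)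
  set M := (moebius : ArithmeticFunction ℝ) with hM
  set f₁ := truncLE V M with hf₁
  set f₂ := truncLE V M * truncLE V vonMangoldt with hf₂
  set a := (M - truncLE V M) * (zeta : ArithmeticFunction ℝ) with ha
  set b := vonMangoldt - truncLE V vonMangoldt with hb
  have e1 : ∀ n ∈ Ioc 0 K, (vonMangoldt n : ℂ) * dyadicPhase c θ X n =
      ((f₁ * ArithmeticFunction.log) n : ℂ) * dyadicPhase c θ X n -
      ((f₂ * (zeta : ArithmeticFunction ℝ)) n : ℂ) * dyadicPhase c θ X n +
      ((a * b) n : ℂ) * dyadicPhase c θ X n := fun n _ => by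
    by_cases hn : (n : ℝ) ≤ X
    · have : dyadicPhase c θ X n = 0 := if_neg fun h => absurd h.1 (not_lt.2 hn)
      simp [this]
    · have h1 : b n = vonMangoldt n := by
        rw [hb, sub_truncLE_apply, if_neg (by push Not at hn ⊢; linarith)]
      have h2 : vonMangoldt n = (f₁ * ArithmeticFunction.log) n -
          (f₂ * (zeta : ArithmeticFunction ℝ)) n + (a * b) n := by
        have hv : b = f₁ * ArithmeticFunction.log - f₂ * (zeta : ArithmeticFunction ℝ) + a * b :=
          vaughan_identity V
        rw [← h1]
        refine (congrArg (fun f : ArithmeticFunction ℝ => f n) hv).trans ?_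
        rw [sub_eq_add_neg, sub_eq_add_neg]
        rfl
      rw [h2]
      push_cast
      ring
  rw [sum_congr rfl e1, sum_add_distrib, sum_sub_distrib, sum_mul_dyadicPhase,
    sum_mul_dyadicPhase, sum_mul_dyadicPhase]
  have hlog0 : (ArithmeticFunction.log 0 : ℝ) = 0 := by simp
  have hz : ∀ n : ℕ, ((zeta : ArithmeticFunction ℝ) n) = if n = 0 then 0 else 1 := fun n => by
    rw [natCoe_apply, zeta_apply]; split_ifs <;> simp
  have t1 := hI θ hθ1 hθ2 f₁ ArithmeticFunction.log 1 ?_ hlog0 ?_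
    (fun d _ => abs_truncLE_moebius_le V d)
  have t2 := hI θ hθ1 hθ2 f₂ (zeta : ArithmeticFunction ℝ) ℓ ?_ (by simp) ?_ ?_
  have t3 := hII θ hθ1 hθ2 a b ?_ ?_ (abs_moebius_mul_zeta_tail_le V) ?_
  · rw [← hK]
    have hXX : X ^ (1 - 0.02904 : ℝ) ≤ X ^ (1 - 0.01452 : ℝ) :=
      rpow_le_rpow_of_exponent_le hX.le (by norm_num)
    have hℓ2 : ℓ ^ 2 ≤ ℓ ^ 4 := pow_le_pow_right₀ hℓ1 (by norm_num)
    have t1' : C₁ * X ^ (1 - 0.02904 : ℝ) * (1 * ArithmeticFunction.log K * ℓ) ≤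
        C₁ * X ^ (1 - 0.01452 : ℝ) * ℓ ^ 4 := by
      rw [log_apply]
      gcongr
      calc 1 * Real.log K * ℓ ≤ ℓ * ℓ := by
            gcongr; linarith
        _ ≤ ℓ ^ 4 := by rw [← sq]; exact hℓ2
    have t2' : C₁ * X ^ (1 - 0.02904 : ℝ) * (ℓ * (zeta : ArithmeticFunction ℝ) K * ℓ) ≤
        C₁ * X ^ (1 - 0.01452 : ℝ) * ℓ ^ 4 := by
      rw [hz, if_neg (by omega)]
      gcongr
      calc ℓ * 1 * ℓ = ℓ ^ 2 := by ring
        _ ≤ ℓ ^ 4 := hℓ2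
    refine (norm_add_le _ _).trans ((add_le_add (norm_sub_le _ _) le_rfl).trans ?_)
    calc _ ≤ C₁ * X ^ (1 - 0.01452 : ℝ) * ℓ ^ 4 + C₁ * X ^ (1 - 0.01452 : ℝ) * ℓ ^ 4 +
          C₂ * X ^ (1 - 0.01452 : ℝ) * ℓ ^ 4 :=
          add_le_add (add_le_add (t1.trans t1') (t2.trans t2')) t3
      _ = _ := by ring
  · intro m hm
    rw [ha, coe_mul_zeta_apply]
    refine sum_eq_zero fun d hd => ?_
    rw [sub_truncLE_apply, if_pos]
    refine le_trans ?_ hm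
    exact_mod_cast Nat.divisor_le hd
  · intro n hn
    rw [hb, sub_truncLE_apply, if_pos hn]
  · intro n hn
    rw [mem_Ioc] at hn
    have hn0 : (0 : ℝ) < n := by exact_mod_cast hn.1
    have h1 : Real.log n ≤ Real.log K := Real.log_le_log hn0 (by exact_mod_cast hn.2)
    rw [hb, sub_truncLE_apply]
    split_ifs
    · rw [abs_zero]; positivity
    · rw [abs_of_nonneg vonMangoldt_nonneg]
      have := vonMangoldt_le_log (n := n)
      linarith
  · intro x y hxy
    rw [hz, hz]
    split_ifs
    · exact le_rfl
    · exact zero_le_one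
    · omega
    · exact le_rfl
  · intro d hd
    rw [hf₂, ArithmeticFunction.mul_apply]
    refine sum_eq_zero fun p hp => ?_
    by_cases h1 : (p.1 : ℝ) ≤ V
    · by_cases h2 : (p.2 : ℝ) ≤ V
      · exfalso
        have h3 : (p.1 : ℝ) * p.2 = d := by
          exact_mod_cast (Nat.mem_divisorsAntidiagonal.1 hp).1
        have : (p.1 : ℝ) * p.2 ≤ V * V := by gcongr
        rw [h3, hVV] at this
        linarith
      · rw [truncLE_apply V vonMangoldt, if_neg h2, mul_zero]
    · rw [truncLE_apply V M, if_neg h1, zero_mul]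
  · intro d hd
    rw [mem_Ioc] at hd
    have hd0 : (0 : ℝ) < d := by exact_mod_cast hd.1
    have h1 : Real.log d ≤ Real.log K := Real.log_le_log hd0 (by exact_mod_cast hd.2)
    have := abs_truncLE_mul_truncLE_le V d
    rw [← hM, ← hf₂] at this
    linarith
  · intro x y hxy
    rw [log_apply, log_apply]
    rcases Nat.eq_zero_or_pos x with rfl | hx
    · simpa using Real.log_natCast_nonneg y
    · exact Real.log_le_log (by exact_mod_cast hx) (by exact_mod_cast hxy)
  · intro d hd
    rw [hf₁, truncLE_apply, if_neg]
    rw [not_le]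
    exact (rpow_le_rpow_of_exponent_le hX.le (by norm_num)).trans_lt hd

lemma ofReal_norm_sq_sum_eC (K : ℕ) (x : ℝ) :
    ((‖∑ j ∈ range K, eC (j * x)‖ ^ 2 : ℝ) : ℂ) =
      ∑ j ∈ range K, ∑ l ∈ range K, eC (((j : ℝ) - l) * x) := by
  rw [← Complex.normSq_eq_norm_sq, ← Complex.mul_conj, map_sum, sum_mul_sum]
  refine sum_congr rfl fun j _ => sum_congr rfl fun l _ => ?_
  rw [← eC_sub, sub_mul]

lemma norm_geom_sum_eC_le (K : ℕ) {δ y : ℝ} (hδ : 0 < δ) (h1 : δ ≤ |y|) (h2 : |y| ≤ 1 - δ) :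
    ‖∑ r ∈ range K, eC (r * y)‖ ≤ 1 / (2 * δ) := by
  have hs : 2 * δ ≤ |sin (π * y)| := by
    have := two_mul_le_sin_pi_mul hδ.le h1 h2
    refine this.trans ?_
    rcases abs_cases y with ⟨h, _⟩ | ⟨h, _⟩
    · rw [h]; exact le_abs_self _
    · rw [h, mul_neg, sin_neg]; exact neg_le_abs _
  have hn : 4 * δ ≤ ‖eC y - 1‖ := by
    rw [norm_sub_rev, norm_one_sub_eC]; linarith
  have hg : (∑ r ∈ range K, eC (r * y)) * (eC y - 1) = eC y ^ K - 1 := by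
    simp only [eC_nsmul]
    exact geom_sum_mul _ _
  have h3 : ‖∑ r ∈ range K, eC (r * y)‖ * ‖eC y - 1‖ ≤ 2 := by
    rw [← norm_mul, hg]
    refine (norm_sub_le _ _).trans ?_
    rw [norm_pow, norm_eC, one_pow, norm_one]
    norm_num
  rw [le_div_iff₀ (by positivity)]
  have := mul_le_mul_of_nonneg_left hn (norm_nonneg (∑ r ∈ range K, eC (r * y)))
  linarith

lemma norm_sum_eC_div_le {α : ℝ} (h0 : 0 ≤ α) (h1 : α ≤ 1) {K h : ℕ} (hh : h < K) :
    ‖∑ r ∈ range K, eC (r * (-((h + α) / K)))‖ ≤ K * ((h + 1 : ℝ)⁻¹ + ((K - h : ℕ) : ℝ)⁻¹) := by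
  have hK : (0 : ℝ) < K := by exact_mod_cast (Nat.zero_le h).trans_lt hh
  have hKh : (0 : ℝ) < (K - h : ℕ) := by exact_mod_cast Nat.sub_pos_of_lt hh
  have hcast : ((K - h : ℕ) : ℝ) = K - h := Nat.cast_sub hh.le
  have hp1 : 0 ≤ (h + 1 : ℝ)⁻¹ := by positivity
  have hp2 : 0 ≤ ((K - h : ℕ) : ℝ)⁻¹ := by positivity
  have htriv : ‖∑ r ∈ range K, eC (r * (-((h + α) / K)))‖ ≤ K := by
    have := norm_sum_eC_le_card (range K) (fun r : ℕ => (r : ℝ) * (-((h + α) / K)))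
    rwa [card_range] at this
  have hy : |(-((h + α) / K) : ℝ)| = (h + α) / K := by
    rw [abs_neg, abs_of_nonneg (by positivity)]
  rcases Nat.eq_zero_or_pos h with rfl | hpos
  · refine htriv.trans ?_
    simp only [Nat.cast_zero, zero_add, inv_one]
    nlinarith
  by_cases hlast : K - h = 1
  · refine htriv.trans ?_
    rw [hlast]
    simp only [Nat.cast_one, inv_one]
    nlinarith
  have hpos' : (1 : ℝ) ≤ h := by exact_mod_cast hpos
  have hK2 : (2 : ℝ) ≤ K - h := by
    rw [← hcast]
    have : 2 ≤ K - h := by omega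
    exact_mod_cast this
  rcases le_or_gt (h : ℝ) (K - 1 - h) with hc | hc
  · have := norm_geom_sum_eC_le K (δ := h / K) (y := -((h + α) / K)) (by positivity)
      (by rw [hy]; gcongr; linarith)
      (by rw [hy, div_le_iff₀ hK, sub_mul, div_mul_cancel₀ _ hK.ne']; linarith)
    refine this.trans ?_
    have e : 1 / (2 * (h / K : ℝ)) = K * (2 * h : ℝ)⁻¹ := by field_simp
    rw [e]
    refine mul_le_mul_of_nonneg_left ?_ hK.le
    have : (2 * h : ℝ)⁻¹ ≤ (h + 1 : ℝ)⁻¹ := by gcongr; linarith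
    linarith
  · have := norm_geom_sum_eC_le K (δ := (K - 1 - h) / K) (y := -((h + α) / K))
      (div_pos (by linarith) hK)
      (by rw [hy]; gcongr; linarith)
      (by rw [hy, div_le_iff₀ hK, sub_mul, div_mul_cancel₀ _ hK.ne']; linarith)
    refine this.trans ?_
    have e : 1 / (2 * ((K - 1 - h) / K : ℝ)) = K * (2 * (K - 1 - h) : ℝ)⁻¹ := by
      have : (K - 1 - h : ℝ) ≠ 0 := by linarith
      field_simp
    rw [e]
    refine mul_le_mul_of_nonneg_left ?_ hK.le
    have : (2 * (K - 1 - h) : ℝ)⁻¹ ≤ ((K - h : ℕ) : ℝ)⁻¹ := by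
      rw [hcast]
      gcongr
      · linarith
    linarith

lemma sum_range_sub_of_periodic {f : ℤ → ℝ} {K : ℕ} (hf : ∀ h, f (h + K) = f h) (l : ℕ) :
    ∑ j ∈ range K, f ((j : ℤ) - l) = ∑ j ∈ range K, f j := by
  induction l with
  | zero => simp
  | succ l ih =>
    rw [← ih]
    rcases K with _ | K
    · simp
    rw [sum_range_succ', sum_range_succ]
    congr 1
    · refine sum_congr rfl fun j _ => ?_
      congr 1
      push_cast
      ring
    · rw [← hf]
      congr 1
      push_cast
      ring

lemma sum_norm_sum_eC_div_le {α : ℝ} (h0 : 0 ≤ α) (h1 : α ≤ 1) (K : ℕ) :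
    ∑ h ∈ range K, ‖∑ r ∈ range K, eC (r * (-((h + α) / K)))‖ ≤ K * (2 * (1 + Real.log K)) := by
  have hH : ∑ h ∈ range K, (h + 1 : ℝ)⁻¹ ≤ 1 + Real.log K := by
    have := harmonic_le_one_add_log K
    rw [harmonic] at this
    push_cast at this
    exact this
  have hH' : ∑ h ∈ range K, ((K - h : ℕ) : ℝ)⁻¹ = ∑ h ∈ range K, (h + 1 : ℝ)⁻¹ := by
    rw [← sum_range_reflect]
    refine sum_congr rfl fun j hj => ?_
    rw [mem_range] at hj
    congr 1
    have : K - (K - 1 - j) = j + 1 := by omega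
    rw [this]
    push_cast
    ring
  calc _ ≤ ∑ h ∈ range K, K * ((h + 1 : ℝ)⁻¹ + ((K - h : ℕ) : ℝ)⁻¹) :=
        sum_le_sum fun h hh => norm_sum_eC_div_le h0 h1 (mem_range.1 hh)
    _ = K * (∑ h ∈ range K, (h + 1 : ℝ)⁻¹ + ∑ h ∈ range K, (h + 1 : ℝ)⁻¹) := by
        rw [← mul_sum, sum_add_distrib, hH']
    _ ≤ K * (2 * (1 + Real.log K)) := by gcongr; linarith

/-- The Fejér kernel of order `K`, normalised so that its translates by the multiples of `1 / K`
form a partition of unity. -/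
noncomputable def fejer (K : ℕ) (x : ℝ) : ℝ := ‖∑ j ∈ range K, eC (j * x)‖ ^ 2 / K ^ 2

lemma fejer_nonneg (K : ℕ) (x : ℝ) : 0 ≤ fejer K x := by unfold fejer; positivity

lemma sum_mul_fejer (K : ℕ) (v : ℕ → ℂ) (x : ℝ) :
    ∑ r ∈ range K, v r * (fejer K (x - r / K) : ℂ) =
      (K ^ 2 : ℂ)⁻¹ * ∑ l ∈ range K, ∑ j ∈ range K, eC (((j : ℝ) - l) * x) *
        ∑ r ∈ range K, v r * eC (r * (-(((j : ℝ) - l) / K))) := by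
  have e : ∀ r ∈ range K, v r * (fejer K (x - r / K) : ℂ) = ∑ l ∈ range K, ∑ j ∈ range K,
      (K ^ 2 : ℂ)⁻¹ * (eC (((j : ℝ) - l) * x) *
        (v r * eC (r * (-(((j : ℝ) - l) / K))))) := fun r _ => by
    rw [fejer, Complex.ofReal_div, ofReal_norm_sq_sum_eC, sum_comm, div_eq_inv_mul, mul_left_comm,
      mul_sum, mul_sum]
    push_cast
    refine sum_congr rfl fun l _ => ?_
    rw [mul_sum, mul_sum]
    refine sum_congr rfl fun j _ => ?_
    have : ((j : ℝ) - l) * (x - r / K) = ((j : ℝ) - l) * x + r * (-(((j : ℝ) - l) / K)) := by ring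
    rw [this, eC_add]
    ring
  rw [sum_congr rfl e, sum_comm, mul_sum]
  refine sum_congr rfl fun l _ => ?_
  rw [sum_comm, mul_sum]
  refine sum_congr rfl fun j _ => ?_
  rw [mul_sum, mul_sum]

lemma sum_eC_div_eq_zero {K : ℕ} {h : ℤ} (h0 : h ≠ 0) (hK : |h| < K) :
    ∑ r ∈ range K, eC (r * (-((h : ℝ) / K))) = 0 := by
  have hK0 : (0 : ℝ) < K := by
    have : (0 : ℤ) < K := (abs_nonneg h).trans_lt hK
    exact_mod_cast this
  have hg : (∑ r ∈ range K, eC (r * (-((h : ℝ) / K)))) * (eC (-((h : ℝ) / K)) - 1) = 0 := by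
    simp only [eC_nsmul]
    rw [geom_sum_mul, ← eC_nsmul]
    have : (K : ℝ) * (-((h : ℝ) / K)) = ((-h : ℤ) : ℝ) := by push_cast; field_simp
    rw [this, eC_intCast, sub_self]
  refine (mul_eq_zero.1 hg).resolve_right fun hz => ?_
  have h1 : (1 : ℝ) ≤ |(h : ℝ)| := by exact_mod_cast Int.one_le_abs h0
  have h2 : |(h : ℝ)| ≤ K - 1 := by
    have : |h| ≤ K - 1 := by omega
    exact_mod_cast this
  have hy : |(-((h : ℝ) / K))| = |(h : ℝ)| / K := by rw [abs_neg, abs_div, abs_of_pos hK0]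
  have hs := two_mul_le_sin_pi_mul (δ := 1 / K) (t := |(h : ℝ)| / K) (by positivity)
    (by gcongr) (by rw [div_le_iff₀ hK0, sub_mul, div_mul_cancel₀ _ hK0.ne']; linarith)
  have h3 : ‖1 - eC (-((h : ℝ) / K))‖ = 0 := by
    rw [norm_sub_rev, hz, norm_zero]
  rw [norm_one_sub_eC] at h3
  have h4 : sin (π * -((h : ℝ) / K)) = 0 := by
    rw [← abs_eq_zero]; linarith
  have h5 : sin (π * (|(h : ℝ)| / K)) = 0 := by
    rcases abs_cases (h : ℝ) with ⟨e, _⟩ | ⟨e, _⟩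
    · rw [e]
      rw [mul_neg, sin_neg, neg_eq_zero] at h4
      exact h4
    · rw [e, neg_div]; exact h4
  rw [h5] at hs
  have : 0 < 1 / (K : ℝ) := by positivity
  linarith

lemma sum_fejer {K : ℕ} (hK : 0 < K) (x : ℝ) :
    ∑ r ∈ range K, fejer K (x - r / K) = 1 := by
  have h := sum_mul_fejer K (fun _ => 1) x
  have e : ∀ l ∈ range K, ∑ j ∈ range K, eC (((j : ℝ) - l) * x) *
      ∑ r ∈ range K, (1 : ℂ) * eC (r * (-(((j : ℝ) - l) / K))) = K := fun l hl => by
    rw [sum_eq_single_of_mem l hl]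
    · simp [eC_zero]
    · intro j hj hjl
      rw [mem_range] at hl hj
      have := sum_eC_div_eq_zero (K := K) (h := (j : ℤ) - l) (by omega) (by rw [abs_lt]; omega)
      push_cast at this
      simp only [one_mul, this, mul_zero]
  rw [sum_congr rfl e] at h
  simp only [one_mul, sum_const, card_range, nsmul_eq_mul] at h
  have hK' : (K : ℂ) ≠ 0 := by exact_mod_cast hK.ne'
  have h2 : ((∑ r ∈ range K, fejer K (x - r / K) : ℝ) : ℂ) = 1 := by
    push_cast
    rw [h]
    field_simp
  exact_mod_cast h2

lemma eC_natCast_mul_sub_intCast (j : ℕ) (x : ℝ) (m : ℤ) : eC (j * (x - m)) = eC (j * x) := by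
  have : (j : ℝ) * (x - m) = j * x - ((j * m : ℤ) : ℝ) := by push_cast; ring
  rw [this, eC_sub_intCast]

lemma fejer_sub_intCast (K : ℕ) (x : ℝ) (m : ℤ) : fejer K (x - m) = fejer K x := by
  simp only [fejer, eC_natCast_mul_sub_intCast]

lemma fejer_le {K : ℕ} {δ y : ℝ} (hδ : 0 < δ) (h1 : δ ≤ |y|) (h2 : |y| ≤ 1 - δ) :
    fejer K y ≤ 1 / (4 * K ^ 2 * δ ^ 2) := by
  have := norm_geom_sum_eC_le K hδ h1 h2
  calc fejer K y ≤ (1 / (2 * δ)) ^ 2 / K ^ 2 := by unfold fejer; gcongr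
    _ = _ := by
      rw [div_pow, one_pow, div_div]
      congr 1
      ring

lemma one_le_four_mul_fejer {L : ℕ} (hL : 0 < L) {x : ℝ} (m : ℤ)
    (hx : |x - m| ≤ 1 / (16 * L)) : 1 ≤ 4 * fejer L x := by
  have hL0 : (0 : ℝ) < L := by exact_mod_cast hL
  rw [← fejer_sub_intCast L x m]
  set y := x - m with hy
  have h1 : ‖(L : ℂ) - ∑ j ∈ range L, eC (j * y)‖ ≤ L / 2 := by
    have e : (L : ℂ) - ∑ j ∈ range L, eC (j * y) = ∑ j ∈ range L, (eC 0 - eC (j * y)) := by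
      rw [sum_sub_distrib, eC_zero]; simp
    rw [e]
    calc _ ≤ ∑ j ∈ range L, (1 / 2 : ℝ) := by
          refine (norm_sum_le _ _).trans (sum_le_sum fun j hj => ?_)
          refine (norm_eC_sub_eC_le _ _).trans ?_
          rw [zero_sub, abs_neg, abs_mul, Nat.abs_cast]
          have hj' : (j : ℝ) ≤ L := by exact_mod_cast (mem_range.1 hj).le
          calc 2 * π * (j * |y|) ≤ 2 * 4 * (L * (1 / (16 * L))) := by
                gcongr
                exact pi_le_four
            _ = 1 / 2 := by field_simp; norm_num
      _ = L / 2 := by rw [sum_const, card_range, nsmul_eq_mul]; ring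
  have h2 : (L : ℝ) / 2 ≤ ‖∑ j ∈ range L, eC (j * y)‖ := by
    have := norm_sub_norm_le (L : ℂ) (∑ j ∈ range L, eC (j * y))
    rw [Complex.norm_natCast] at this
    linarith
  have h3 : ((L : ℝ) / 2) ^ 2 ≤ ‖∑ j ∈ range L, eC (j * y)‖ ^ 2 := by gcongr
  unfold fejer
  rw [← mul_div_assoc, le_div_iff₀ (by positivity)]
  linarith

/-- The Fejér mean of `x ↦ e(-α {x})`. -/
noncomputable def fejerMean (K : ℕ) (α x : ℝ) : ℂ :=
  ∑ r ∈ range K, eC (-(α * (r / K))) * (fejer K (x - r / K) : ℂ)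

lemma norm_fejerMean_sub_le {K : ℕ} (hK : 0 < K) (α x : ℝ) :
    ‖fejerMean K α x - eC (-(α * Int.fract x))‖ ≤
      ∑ r ∈ range K, ‖eC (-(α * (r / K))) - eC (-(α * Int.fract x))‖ * fejer K (x - r / K) := by
  have e : fejerMean K α x - eC (-(α * Int.fract x)) =
      ∑ r ∈ range K, (eC (-(α * (r / K))) - eC (-(α * Int.fract x))) *
        (fejer K (x - r / K) : ℂ) := by
    simp only [sub_mul, sum_sub_distrib, ← mul_sum, ← Complex.ofReal_sum]
    rw [sum_fejer hK, Complex.ofReal_one, mul_one, fejerMean]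
  rw [e]
  refine (norm_sum_le _ _).trans (sum_le_sum fun r _ => ?_)
  rw [norm_mul, Complex.norm_real, Real.norm_of_nonneg (fejer_nonneg _ _)]

lemma norm_eC_sub_eC_le_two (x y : ℝ) : ‖eC x - eC y‖ ≤ 2 := by
  refine (norm_sub_le _ _).trans ?_
  rw [norm_eC, norm_eC]; norm_num

lemma norm_fejerMean_sub_le_two {K : ℕ} (hK : 0 < K) (α x : ℝ) :
    ‖fejerMean K α x - eC (-(α * Int.fract x))‖ ≤ 2 := by
  refine (norm_fejerMean_sub_le hK α x).trans ?_
  calc _ ≤ ∑ r ∈ range K, 2 * fejer K (x - r / K) := by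
        refine sum_le_sum fun r _ => ?_
        exact mul_le_mul_of_nonneg_right (norm_eC_sub_eC_le_two _ _) (fejer_nonneg _ _)
    _ = 2 := by rw [← mul_sum, sum_fejer hK, mul_one]

lemma norm_fejerMean_sub_le_of_mem {R : ℕ} (hR : 0 < R) {α x : ℝ} (h0 : 0 ≤ α) (h1 : α ≤ 1)
    (hx1 : 1 / R ≤ Int.fract x) (hx2 : Int.fract x ≤ 1 - 1 / R) :
    ‖fejerMean (R ^ 3) α x - eC (-(α * Int.fract x))‖ ≤ 8 / R := by
  have hR0 : (0 : ℝ) < R := by exact_mod_cast hR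
  set K := R ^ 3 with hK
  have hKR : (K : ℝ) = R ^ 3 := by rw [hK]; push_cast; rfl
  have hK0 : 0 < K := by positivity
  have hK0' : (0 : ℝ) < K := by exact_mod_cast hK0
  set t := Int.fract x with ht
  refine (norm_fejerMean_sub_le hK0 α x).trans ?_
  have key : ∀ r ∈ range K, ‖eC (-(α * (r / K))) - eC (-(α * t))‖ * fejer K (x - r / K) ≤
      2 * π / R * fejer K (x - r / K) + 2 * (1 / (4 * K ^ 2 * (1 / R : ℝ) ^ 2)) := by
    intro r hr
    have hf0 := fejer_nonneg K (x - r / K)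
    rcases le_or_gt (|t - r / K|) (1 / R) with hd | hd
    · have h2 : ‖eC (-(α * (r / K))) - eC (-(α * t))‖ ≤ 2 * π / R := by
        refine (norm_eC_sub_eC_le _ _).trans ?_
        have e : -(α * (r / K : ℝ)) - -(α * t) = α * (t - r / K) := by ring
        rw [e, abs_mul, abs_of_nonneg h0]
        calc 2 * π * (α * |t - r / K|) ≤ 2 * π * (1 * (1 / R)) := by gcongr
          _ = _ := by ring
      have h3 : 0 ≤ 2 * (1 / (4 * K ^ 2 * (1 / R : ℝ) ^ 2)) := by positivity
      nlinarith
    · have h2 : fejer K (x - r / K) ≤ 1 / (4 * K ^ 2 * (1 / R : ℝ) ^ 2) := by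
        have e : x - r / K = (t - r / K) - ((-⌊x⌋ : ℤ) : ℝ) := by
          rw [ht, Int.fract]; push_cast; ring
        rw [e, fejer_sub_intCast]
        refine fejer_le (by positivity) hd.le ?_
        have hr0 : (0 : ℝ) ≤ r / K := by positivity
        have hr1 : (r / K : ℝ) ≤ 1 := by
          rw [div_le_one hK0']
          exact_mod_cast (mem_range.1 hr).le
        rw [abs_le]
        constructor <;> linarith
      have h3 := norm_eC_sub_eC_le_two (-(α * (r / K))) (-(α * t))
      have h4 : 0 ≤ 2 * π / R * fejer K (x - r / K) := by positivity
      have h5 : ‖eC (-(α * (r / K))) - eC (-(α * t))‖ * fejer K (x - r / K) ≤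
        2 * (1 / (4 * K ^ 2 * (1 / R : ℝ) ^ 2)) := by gcongr
      linarith
  refine (sum_le_sum key).trans ?_
  rw [sum_add_distrib, ← mul_sum, sum_fejer hK0, sum_const, card_range, nsmul_eq_mul, hKR]
  have e : (R : ℝ) ^ 3 * (2 * (1 / (4 * ((R : ℝ) ^ 3) ^ 2 * (1 / R : ℝ) ^ 2))) = (1 / 2) / R := by
    field_simp; norm_num
  rw [e, mul_one, ← add_div]
  gcongr
  linarith [pi_lt_d2]

lemma norm_fejerMean_sub_le_fejer {L : ℕ} (hL : 0 < L) {α : ℝ} (h0 : 0 ≤ α) (h1 : α ≤ 1) (x : ℝ) :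
    ‖fejerMean ((16 * L) ^ 3) α x - eC (-(α * Int.fract x))‖ ≤ 1 / L + 8 * fejer L x := by
  have hL0 : (0 : ℝ) < L := by exact_mod_cast hL
  have hf := fejer_nonneg L x
  have hc : ((16 * L : ℕ) : ℝ) = 16 * L := by push_cast; rfl
  by_cases hx : 1 / ((16 * L : ℕ) : ℝ) ≤ Int.fract x ∧
      Int.fract x ≤ 1 - 1 / ((16 * L : ℕ) : ℝ)
  · have := norm_fejerMean_sub_le_of_mem (by positivity) h0 h1 hx.1 hx.2
    rw [hc] at this
    have e : 8 / (16 * L : ℝ) ≤ 1 / L := by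
      rw [div_le_div_iff₀ (by positivity) hL0]; linarith
    linarith
  · have h2 := norm_fejerMean_sub_le_two (show 0 < (16 * L) ^ 3 by positivity) α x
    have h3 : 1 ≤ 4 * fejer L x := by
      rw [hc] at hx
      have hfr := Int.fract_nonneg x
      have hfr1 := (Int.fract_lt_one x).le
      have e : x = ⌊x⌋ + Int.fract x := (Int.floor_add_fract x).symm
      by_cases h4 : 1 / (16 * L : ℝ) ≤ Int.fract x
      · refine one_le_four_mul_fejer hL (⌊x⌋ + 1) ?_
        have h5 : ¬ Int.fract x ≤ 1 - 1 / (16 * L : ℝ) := fun h => hx ⟨h4, h⟩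
        push_cast
        rw [abs_le]
        constructor <;> linarith
      · refine one_le_four_mul_fejer hL ⌊x⌋ ?_
        rw [abs_le]
        constructor <;> linarith
    have : 0 ≤ 1 / (L : ℝ) := by positivity
    linarith

lemma sum_mul_fejer_le {ι : Type*} {s : Finset ι} {w x : ι → ℝ} (hw : ∀ i ∈ s, 0 ≤ w i) {L : ℕ}
    (hL : 0 < L) {E : ℝ} (hE : 0 ≤ E)
    (hE1 : ∀ h : ℤ, h ≠ 0 → |h| < L → ‖∑ i ∈ s, (w i : ℂ) * eC (h * x i)‖ ≤ E) :
    ∑ i ∈ s, w i * fejer L (x i) ≤ (∑ i ∈ s, w i) / L + E := by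
  have hL0 : (0 : ℝ) < L := by exact_mod_cast hL
  have hW : 0 ≤ ∑ i ∈ s, w i := sum_nonneg hw
  have e : ((∑ i ∈ s, w i * ‖∑ j ∈ range L, eC (j * x i)‖ ^ 2 : ℝ) : ℂ) =
      ∑ j ∈ range L, ∑ l ∈ range L, ∑ i ∈ s, (w i : ℂ) * eC (((j : ℝ) - l) * x i) := by
    rw [Complex.ofReal_sum]
    have : ∀ i ∈ s, ((w i * ‖∑ j ∈ range L, eC (j * x i)‖ ^ 2 : ℝ) : ℂ) =
        ∑ j ∈ range L, ∑ l ∈ range L, (w i : ℂ) * eC (((j : ℝ) - l) * x i) := fun i _ => by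
      rw [Complex.ofReal_mul, ofReal_norm_sq_sum_eC, mul_sum]
      simp only [mul_sum]
    rw [sum_congr rfl this, sum_comm]
    refine sum_congr rfl fun j _ => ?_
    rw [sum_comm]
  have hpos : 0 ≤ ∑ i ∈ s, w i * ‖∑ j ∈ range L, eC (j * x i)‖ ^ 2 :=
    sum_nonneg fun i hi => mul_nonneg (hw i hi) (by positivity)
  have hbound : ∑ i ∈ s, w i * ‖∑ j ∈ range L, eC (j * x i)‖ ^ 2 ≤
      L * (∑ i ∈ s, w i) + L * (L * E) := by
    have h1 := congrArg norm e
    rw [Complex.norm_real, Real.norm_of_nonneg hpos] at h1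
    rw [h1]
    have h2 : ∀ j ∈ range L, ∀ l ∈ range L,
        ‖∑ i ∈ s, (w i : ℂ) * eC (((j : ℝ) - l) * x i)‖ ≤
          (if j = l then ∑ i ∈ s, w i else 0) + E := by
      intro j hj l hl
      rw [mem_range] at hj hl
      split_ifs with hjl
      · subst hjl
        have : ‖∑ i ∈ s, (w i : ℂ) * eC (((j : ℝ) - j) * x i)‖ ≤ ∑ i ∈ s, w i := by
          refine (norm_sum_le _ _).trans (sum_le_sum fun i hi => ?_)
          rw [norm_mul, norm_eC, mul_one, Complex.norm_real, Real.norm_of_nonneg (hw i hi)]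
        linarith
      · have := hE1 ((j : ℤ) - l) (by omega) (by rw [abs_lt]; omega)
        push_cast at this
        linarith
    refine (norm_sum_le _ _).trans ((sum_le_sum fun j hj => (norm_sum_le _ _).trans
      (sum_le_sum fun l hl => h2 j hj l hl)).trans ?_)
    simp only [sum_add_distrib, sum_ite_eq, sum_const, card_range, nsmul_eq_mul]
    rw [sum_congr rfl fun j hj => if_pos hj]
    simp
  have e2 : ∑ i ∈ s, w i * fejer L (x i) =
      (∑ i ∈ s, w i * ‖∑ j ∈ range L, eC (j * x i)‖ ^ 2) / L ^ 2 := by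
    rw [sum_div]
    refine sum_congr rfl fun i _ => ?_
    rw [fejer, mul_div_assoc]
  rw [e2, div_le_iff₀ (by positivity)]
  refine hbound.trans (le_of_eq ?_)
  field_simp

lemma norm_sum_mul_fejerMean_le {ι : Type*} {s : Finset ι} {w x : ι → ℝ} {α : ℝ} (h0 : 0 ≤ α)
    (h1 : α ≤ 1) {K : ℕ} (hK : 0 < K) {E : ℝ} (hE : 0 ≤ E)
    (hE2 : ∀ h : ℤ, |h| < K → ‖∑ i ∈ s, (w i : ℂ) * eC ((h + α) * x i)‖ ≤ E) :
    ‖∑ i ∈ s, (w i : ℂ) * eC (α * x i) * fejerMean K α (x i)‖ ≤ 2 * (1 + Real.log K) * E := by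
  have hK0 : (0 : ℝ) < K := by exact_mod_cast hK
  set G : ℤ → ℂ := fun h => ∑ r ∈ range K, eC (r * (-((h + α) / K))) with hG
  have hGper : ∀ h, ‖G (h + K)‖ = ‖G h‖ := fun h => by
    congr 1
    refine sum_congr rfl fun r _ => ?_
    have : (r : ℝ) * (-((((h + K : ℤ) : ℝ) + α) / K)) = r * (-((h + α) / K)) - ((r : ℤ) : ℝ) := by
      push_cast; field_simp; ring
    rw [this, eC_sub_intCast]
  have e : ∑ i ∈ s, (w i : ℂ) * eC (α * x i) * fejerMean K α (x i) =
      (K ^ 2 : ℂ)⁻¹ * ∑ l ∈ range K, ∑ j ∈ range K, G ((j : ℤ) - l) *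
        ∑ i ∈ s, (w i : ℂ) * eC ((((j : ℤ) - l : ℤ) + α) * x i) := by
    have e1 : ∀ i ∈ s, (w i : ℂ) * eC (α * x i) * fejerMean K α (x i) =
        (K ^ 2 : ℂ)⁻¹ * ∑ l ∈ range K, ∑ j ∈ range K, G ((j : ℤ) - l) *
          ((w i : ℂ) * eC ((((j : ℤ) - l : ℤ) + α) * x i)) := fun i _ => by
      rw [fejerMean, sum_mul_fejer, mul_left_comm, mul_sum]
      congr 1
      refine sum_congr rfl fun l _ => ?_
      rw [mul_sum]
      refine sum_congr rfl fun j _ => ?_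
      have e2 : ∑ r ∈ range K, eC (-(α * (r / K))) * eC (r * (-(((j : ℝ) - l) / K))) =
          G ((j : ℤ) - l) := by
        refine sum_congr rfl fun r _ => ?_
        rw [← eC_add]
        congr 1
        push_cast
        ring
      rw [e2]
      have e3 : (((j : ℤ) - l : ℤ) + α) * x i = α * x i + ((j : ℝ) - l) * x i := by
        push_cast; ring
      rw [e3, eC_add]
      ring
    rw [sum_congr rfl e1, ← mul_sum, sum_comm]
    congr 1
    refine sum_congr rfl fun l _ => ?_
    rw [sum_comm]
    simp only [mul_sum]
  have hl : ∀ l ∈ range K, ‖∑ j ∈ range K, G ((j : ℤ) - l) *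
        ∑ i ∈ s, (w i : ℂ) * eC ((((j : ℤ) - l : ℤ) + α) * x i)‖ ≤
      K * (2 * (1 + Real.log K)) * E := by
    intro l hl
    have h2 : ∑ j ∈ range K, ‖G ((j : ℤ) - l)‖ ≤ K * (2 * (1 + Real.log K)) := by
      rw [sum_range_sub_of_periodic (f := fun h => ‖G h‖) hGper]
      have := sum_norm_sum_eC_div_le h0 h1 K
      simpa only [hG, Int.cast_natCast] using this
    calc _ ≤ ∑ j ∈ range K, ‖G ((j : ℤ) - l)‖ * E := by
          refine (norm_sum_le _ _).trans (sum_le_sum fun j hj => ?_)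
          rw [norm_mul]
          refine mul_le_mul_of_nonneg_left (hE2 _ ?_) (norm_nonneg _)
          rw [mem_range] at hj hl
          rw [abs_lt]; omega
      _ ≤ _ := by rw [← sum_mul]; gcongr
  rw [e, norm_mul, norm_inv, norm_pow, Complex.norm_natCast]
  calc _ ≤ ((K : ℝ) ^ 2)⁻¹ * ∑ l ∈ range K, K * (2 * (1 + Real.log K)) * E := by
        gcongr
        exact (norm_sum_le _ _).trans (sum_le_sum hl)
    _ = _ := by rw [sum_const, card_range, nsmul_eq_mul]; field_simp

/-- Reduction of an exponential sum over integer parts to exponential sums without them. -/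
lemma norm_sum_eC_floor_le {ι : Type*} {s : Finset ι} {w x : ι → ℝ} (hw : ∀ i ∈ s, 0 ≤ w i) {α : ℝ}
    (h0 : 0 ≤ α) (h1 : α ≤ 1) {L : ℕ} (hL : 0 < L) {E : ℝ} (hE : 0 ≤ E)
    (hE1 : ∀ h : ℤ, h ≠ 0 → |h| < L → ‖∑ i ∈ s, (w i : ℂ) * eC (h * x i)‖ ≤ E)
    (hE2 : ∀ h : ℤ, |h| < ((16 * L) ^ 3 : ℕ) →
      ‖∑ i ∈ s, (w i : ℂ) * eC ((h + α) * x i)‖ ≤ E) :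
    ‖∑ i ∈ s, (w i : ℂ) * eC (⌊x i⌋ * α)‖ ≤
      2 * (1 + Real.log ((16 * L) ^ 3 : ℕ)) * E + 9 * (∑ i ∈ s, w i) / L + 8 * E := by
  set K := (16 * L) ^ 3 with hK
  have hL0 : (0 : ℝ) < L := by exact_mod_cast hL
  have e : ∑ i ∈ s, (w i : ℂ) * eC (⌊x i⌋ * α) =
      ∑ i ∈ s, (w i : ℂ) * eC (α * x i) * fejerMean K α (x i) -
      ∑ i ∈ s, (w i : ℂ) * eC (α * x i) *
        (fejerMean K α (x i) - eC (-(α * Int.fract (x i)))) := by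
    rw [← sum_sub_distrib]
    refine sum_congr rfl fun i _ => ?_
    have : (⌊x i⌋ : ℝ) * α = α * x i + -(α * Int.fract (x i)) := by
      rw [Int.fract]; ring
    rw [this, eC_add]
    ring
  have h2 := norm_sum_mul_fejerMean_le (s := s) (w := w) (x := x) h0 h1
    (show 0 < K by positivity) hE hE2
  have h3 : ‖∑ i ∈ s, (w i : ℂ) * eC (α * x i) *
        (fejerMean K α (x i) - eC (-(α * Int.fract (x i))))‖ ≤
      9 * (∑ i ∈ s, w i) / L + 8 * E := by
    calc _ ≤ ∑ i ∈ s, w i * (1 / L + 8 * fejer L (x i)) := by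
          refine (norm_sum_le _ _).trans (sum_le_sum fun i hi => ?_)
          rw [norm_mul, norm_mul, norm_eC, mul_one, Complex.norm_real,
            Real.norm_of_nonneg (hw i hi)]
          exact mul_le_mul_of_nonneg_left (norm_fejerMean_sub_le_fejer hL h0 h1 (x i)) (hw i hi)
      _ = (∑ i ∈ s, w i) / L + 8 * ∑ i ∈ s, w i * fejer L (x i) := by
          rw [sum_div, mul_sum, ← sum_add_distrib]
          refine sum_congr rfl fun i _ => ?_
          ring
      _ ≤ (∑ i ∈ s, w i) / L + 8 * ((∑ i ∈ s, w i) / L + E) := by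
          gcongr
          exact sum_mul_fejer_le hw hL hE hE1
      _ = _ := by ring
  rw [e]
  refine (norm_sub_le _ _).trans ?_
  linarith

/-! ### The size of the frequencies and the final estimate -/

lemma eventually_rpow_le_rpow_mul_rpow {c ε A : ℝ} (hc1 : 1 < c)
    (hc2 : c < 4109054 / 1999527) (hε : 0 < ε) (hε1 : ε ≤ 1 / 1000) (hA : 0 < A) :
    ∀ᶠ X : ℝ in Filter.atTop, ∀ P : ℝ, 0 < P → A⁻¹ * P ^ ((9449 : ℝ) / 10000) ≤ X →
      X ^ (0.93 : ℝ) ≤ P ^ (1 - c - ε) * X ^ c := by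
  set q : ℝ := (1 - c - ε) / (9449 / 10000) with hq
  have hq0 : q ≤ 0 := div_nonpos_of_nonpos_of_nonneg (by linarith) (by norm_num)
  have hqc : 0.935 ≤ q + c := by
    rw [hq, div_add' _ _ _ (by norm_num), le_div_iff₀ (by norm_num)]
    linarith
  have ht := (tendsto_rpow_atTop (show (0 : ℝ) < 0.005 by norm_num)).eventually_ge_atTop (A ^ q)⁻¹
  filter_upwards [ht, Filter.eventually_ge_atTop 1] with X h1 hX P hP h
  have hX0 : 0 < X := by linarith
  have hAq : 0 < A ^ q := rpow_pos_of_pos hA _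
  have hP' : P ^ ((9449 : ℝ) / 10000) ≤ A * X := by
    rwa [inv_mul_le_iff₀ hA] at h
  have e : P ^ (1 - c - ε) = (P ^ ((9449 : ℝ) / 10000)) ^ q := by
    rw [← rpow_mul hP.le, hq, mul_div_cancel₀ _ (by norm_num)]
  have h2 : (A * X) ^ q ≤ P ^ (1 - c - ε) := by
    rw [e]
    exact rpow_le_rpow_of_nonpos (rpow_pos_of_pos hP _) hP' hq0
  have h3 : 1 ≤ A ^ q * X ^ (0.005 : ℝ) := by
    rwa [inv_le_iff_one_le_mul₀' hAq] at h1
  calc X ^ (0.93 : ℝ) ≤ A ^ q * X ^ (0.005 : ℝ) * X ^ (0.93 : ℝ) :=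
        le_mul_of_one_le_left (by positivity) h3
    _ = A ^ q * X ^ (0.935 : ℝ) := by
        rw [mul_assoc, ← rpow_add hX0]; norm_num
    _ ≤ A ^ q * X ^ (q + c) :=
        mul_le_mul_of_nonneg_left (rpow_le_rpow_of_exponent_le hX hqc) hAq.le
    _ = (A * X) ^ q * X ^ c := by
        rw [mul_rpow hA.le hX0.le, rpow_add hX0, mul_assoc]
    _ ≤ _ := mul_le_mul_of_nonneg_right h2 (by positivity)

lemma eventually_one_add_log_floor_pow_le :
    ∀ᶠ X : ℝ in Filter.atTop, (1 + Real.log ⌊2 * X⌋₊) ^ 5 ≤ X ^ (0.000008 : ℝ) := by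
  have h : (fun X : ℝ => Real.log X) =o[Filter.atTop] fun X => X ^ (0.0000016 : ℝ) :=
    isLittleO_log_rpow_atTop (by norm_num)
  have h1 := h.bound (show (0 : ℝ) < 1 / 2 by norm_num)
  have h2 := (tendsto_rpow_atTop (show (0 : ℝ) < 0.0000016 by norm_num)).eventually_ge_atTop 4
  filter_upwards [h1, h2, Filter.eventually_ge_atTop 1] with X h1 h2 hX
  have hX0 : 0 < X := by linarith
  rw [norm_of_nonneg (Real.log_nonneg hX), norm_of_nonneg (by positivity)] at h1
  have hf : (1 : ℝ) ≤ ⌊2 * X⌋₊ := by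
    exact_mod_cast Nat.le_floor (by push_cast; linarith)
  have h3 : Real.log ⌊2 * X⌋₊ ≤ 1 + Real.log X := by
    refine (Real.log_le_log (by linarith) (Nat.floor_le (by positivity))).trans ?_
    rw [Real.log_mul two_ne_zero hX0.ne']
    linarith [Real.log_two_lt_d9]
  calc (1 + Real.log ⌊2 * X⌋₊) ^ 5 ≤ (X ^ (0.0000016 : ℝ)) ^ 5 := by
        have := Real.log_nonneg hf
        gcongr
        linarith
    _ = _ := by
        rw [← rpow_natCast, ← rpow_mul hX0.le]
        norm_num

lemma sum_vonMangoldt_Ioc_le {X : ℝ} (hX : 0 ≤ X) :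
    ∑ n ∈ Ioc ⌊X⌋₊ ⌊2 * X⌋₊, vonMangoldt n ≤ 2 * X * (1 + Real.log ⌊2 * X⌋₊) := by
  have hl : 0 ≤ Real.log ⌊2 * X⌋₊ := Real.log_natCast_nonneg _
  calc _ ≤ ∑ n ∈ Ioc ⌊X⌋₊ ⌊2 * X⌋₊, (1 + Real.log ⌊2 * X⌋₊) := by
        refine sum_le_sum fun n hn => vonMangoldt_le_log.trans ?_
        obtain ⟨h1, h2⟩ := mem_Ioc.mp hn
        have : Real.log n ≤ Real.log ⌊2 * X⌋₊ :=
          Real.log_le_log (by exact_mod_cast (by omega)) (by exact_mod_cast h2)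
        linarith
    _ = (⌊2 * X⌋₊ - ⌊X⌋₊ : ℕ) * (1 + Real.log ⌊2 * X⌋₊) := by
        rw [sum_const, Nat.card_Ioc, nsmul_eq_mul]
    _ ≤ _ := by
        gcongr
        refine le_trans ?_ (Nat.floor_le (show 0 ≤ 2 * X by positivity))
        exact_mod_cast Nat.sub_le _ _

lemma exists_norm_sum_vonMangoldt_floor_le {c : ℝ} (hc1 : 1 < c)
    (hc2 : c < 4109054 / 1999527) (hc3 : c ≠ 2) :
    ∃ C : ℝ, 0 < C ∧ ∀ᶠ X : ℝ in Filter.atTop, ∀ α τ : ℝ, τ ≤ 1 → τ < α → α < 1 - τ →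
      0 < τ → X ^ (0.93 : ℝ) ≤ τ * X ^ c →
      ‖∑ n ∈ Ioc ⌊X⌋₊ ⌊2 * X⌋₊, (vonMangoldt n : ℂ) * eC ((⌊(n : ℝ) ^ c⌋ : ℝ) * α)‖ ≤
        C * X ^ ((2627349 : ℝ) / 2666036) := by
  obtain ⟨C, hC, hev⟩ := exists_sum_vonMangoldt_le hc1 hc2 hc3
  refine ⟨10 * C + 18, by positivity, ?_⟩
  have ht := (tendsto_rpow_atTop (show (0 : ℝ) < 0.00004 by norm_num)).eventually_ge_atTop 40000
  filter_upwards [hev, eventually_one_add_log_floor_pow_le, ht, Filter.eventually_ge_atTop 1]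
    with X hev hlog ht hX α τ hτ1 hα1 hα2 hτ0 hτ
  have hX0 : 0 < X := by linarith
  set l := 1 + Real.log ⌊2 * X⌋₊ with hl
  have hl1 : 1 ≤ l := le_add_of_nonneg_right (Real.log_natCast_nonneg _)
  set L := ⌈X ^ (0.01452 : ℝ)⌉₊ with hL
  have hX1 : 1 ≤ X ^ (0.01452 : ℝ) := one_le_rpow hX (by norm_num)
  have hL1 : X ^ (0.01452 : ℝ) ≤ L := Nat.le_ceil _
  have hL2 : (L : ℝ) ≤ 2 * X ^ (0.01452 : ℝ) := by
    have := Nat.ceil_lt_add_one (show 0 ≤ X ^ (0.01452 : ℝ) by positivity)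
    rw [← hL] at this
    linarith
  have hL0 : 0 < L := Nat.ceil_pos.mpr (by positivity)
  have hL0' : (1 : ℝ) ≤ L := by exact_mod_cast hL0
  have hK : (((16 * L) ^ 3 : ℕ) : ℝ) + 1 ≤ X ^ (0.0436 : ℝ) := by
    calc (((16 * L) ^ 3 : ℕ) : ℝ) + 1 ≤ 40000 * (X ^ (0.01452 : ℝ)) ^ 3 := by
          push_cast
          have h3 : (16 * (L : ℝ)) ^ 3 ≤ (16 * (2 * X ^ (0.01452 : ℝ))) ^ 3 := by gcongr
          have h4 : 1 ≤ (X ^ (0.01452 : ℝ)) ^ 3 := one_le_pow₀ hX1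
          nlinarith
      _ ≤ X ^ (0.00004 : ℝ) * (X ^ (0.01452 : ℝ)) ^ 3 := by gcongr
      _ = _ := by
          rw [← rpow_natCast, ← rpow_mul hX0.le, ← rpow_add hX0]
          norm_num
  have hLK : (L : ℝ) ≤ ((16 * L) ^ 3 : ℕ) := by
    push_cast
    nlinarith [pow_le_pow_left₀ zero_le_one hL0' 2]
  have hKl : 1 + Real.log ((16 * L) ^ 3 : ℕ) ≤ l := by
    have : (16 * L) ^ 3 ≤ ⌊2 * X⌋₊ := by
      refine Nat.le_floor ?_
      have : X ^ (0.0436 : ℝ) ≤ X := by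
        simpa using rpow_le_rpow_of_exponent_le hX (show (0.0436 : ℝ) ≤ 1 by norm_num)
      linarith
    have := Real.log_le_log (x := ((16 * L) ^ 3 : ℕ)) (by positivity) (Nat.cast_le.mpr this)
    linarith
  have hτX : ∀ θ : ℝ, τ ≤ |θ| → X ^ (0.93 : ℝ) ≤ |θ| * X ^ c := fun θ h =>
    hτ.trans (mul_le_mul_of_nonneg_right h (by positivity))
  set E := C * X ^ (1 - 0.01452 : ℝ) * l ^ 4 with hE
  have key := norm_sum_eC_floor_le (s := Ioc ⌊X⌋₊ ⌊2 * X⌋₊) (w := fun n => vonMangoldt n)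
    (x := fun n => (n : ℝ) ^ c) (fun _ _ => vonMangoldt_nonneg) (α := α) (by linarith)
    (by linarith) hL0 (E := E) (by positivity) (fun h h0 h1 => ?_) (fun h h1 => ?_)
  · have hM := sum_vonMangoldt_Ioc_le hX0.le
    have hM2 : 9 * (∑ n ∈ Ioc ⌊X⌋₊ ⌊2 * X⌋₊, vonMangoldt n) / L ≤
        18 * l * X ^ (1 - 0.01452 : ℝ) := by
      rw [div_le_iff₀ (by positivity)]
      have : X ≤ X ^ (1 - 0.01452 : ℝ) * L := by
        calc X = X ^ (1 - 0.01452 : ℝ) * X ^ (0.01452 : ℝ) := by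
              rw [← rpow_add hX0]; norm_num
          _ ≤ _ := by gcongr
      nlinarith
    have hE0 : 0 ≤ E := by positivity
    have hY : 0 ≤ X ^ (1 - 0.01452 : ℝ) := by positivity
    have hl45 : l ^ 4 ≤ l ^ 5 := pow_le_pow_right₀ hl1 (by norm_num)
    have hl15 : l ≤ l ^ 5 := le_self_pow₀ hl1 (by norm_num)
    calc _ ≤ _ := key
      _ ≤ 2 * l * E + 18 * l * X ^ (1 - 0.01452 : ℝ) + 8 * E := by gcongr
      _ = (2 * C * l ^ 5 + 18 * l + 8 * C * l ^ 4) * X ^ (1 - 0.01452 : ℝ) := by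
          rw [hE]; ring
      _ ≤ (2 * C * l ^ 5 + 18 * l ^ 5 + 8 * C * l ^ 5) * X ^ (1 - 0.01452 : ℝ) := by gcongr
      _ = (10 * C + 18) * (l ^ 5 * X ^ (1 - 0.01452 : ℝ)) := by ring
      _ ≤ (10 * C + 18) * (X ^ (0.000008 : ℝ) * X ^ (1 - 0.01452 : ℝ)) := by gcongr
      _ ≤ _ := by
          rw [← rpow_add hX0]
          refine mul_le_mul_of_nonneg_left ?_ (by positivity)
          exact rpow_le_rpow_of_exponent_le hX (by norm_num)
  · refine hev h (hτX _ ?_) ?_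
    · have : (1 : ℝ) ≤ |(h : ℝ)| := by exact_mod_cast Int.one_le_abs h0
      linarith
    · have : |(h : ℝ)| ≤ L := by exact_mod_cast h1.le
      linarith
  · refine hev (h + α) (hτX _ ?_) ?_
    · rcases lt_trichotomy h (-1) with h2 | h2 | h2
      · have : (h : ℝ) ≤ -2 := by exact_mod_cast (by omega : h ≤ -2)
        rw [abs_of_neg (by linarith)]
        linarith
      · rw [h2, abs_of_neg (by push_cast; linarith)]
        push_cast
        linarith
      · have : (0 : ℝ) ≤ h := by exact_mod_cast (by omega : 0 ≤ h)
        rw [abs_of_nonneg (by linarith)]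
        linarith
    · have h2 : |(h : ℝ)| ≤ ((16 * L) ^ 3 : ℕ) := by exact_mod_cast h1.le
      have h3 : |α| ≤ 1 := by
        rw [abs_of_pos (by linarith)]
        linarith
      linarith [abs_add_le (h : ℝ) α]

theorem stmt_14 (c : ℝ) (hc1 : 1 < c) (hc2 : c < 4109054 / 1999527) (hc3 : c ≠ 2) :
    ∃ ε₀ > 0, ∀ ε : ℝ, 0 < ε → ε ≤ ε₀ → ∀ A : ℝ, 0 < A →
      ∃ C > 0, ∃ P₀ : ℝ, ∀ P : ℝ, P₀ ≤ P →
        ∀ X : ℝ, A⁻¹ * P ^ ((9449 : ℝ) / 10000) ≤ X → X ≤ A * P →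
          ∀ α : ℝ, P ^ (1 - c - ε) < α → α < 1 - P ^ (1 - c - ε) →
            ‖∑ n ∈ Finset.Ioc ⌊X⌋₊ ⌊2 * X⌋₊,
                (ArithmeticFunction.vonMangoldt n : ℂ) * eC ((⌊(n : ℝ) ^ c⌋ : ℝ) * α)‖
              ≤ C * X ^ ((2627349 : ℝ) / 2666036 + ε) := by
  refine ⟨1 / 1000, by norm_num, fun ε hε hε1 A hA => ?_⟩
  obtain ⟨C, hC, hev⟩ := exists_norm_sum_vonMangoldt_floor_le hc1 hc2 hc3
  refine ⟨C, hC, ?_⟩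
  obtain ⟨X₀, hX₀⟩ := Filter.eventually_atTop.mp ((hev.and
    (eventually_rpow_le_rpow_mul_rpow hc1 hc2 hε hε1 hA)).and (Filter.eventually_ge_atTop 1))
  have ht : Filter.Tendsto (fun P : ℝ => A⁻¹ * P ^ ((9449 : ℝ) / 10000)) Filter.atTop
      Filter.atTop := (tendsto_rpow_atTop (by norm_num)).const_mul_atTop (inv_pos.mpr hA)
  obtain ⟨P₀, hP₀⟩ := Filter.eventually_atTop.mp
    ((ht.eventually_ge_atTop X₀).and (Filter.eventually_ge_atTop 1))
  refine ⟨P₀, fun P hP X hX _ α hα1 hα2 => ?_⟩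
  obtain ⟨h1, hP1⟩ := hP₀ P hP
  obtain ⟨⟨h2, h3⟩, hX1⟩ := hX₀ X (h1.trans hX)
  have hP0 : 0 < P := by linarith
  refine (h2 α (P ^ (1 - c - ε)) (rpow_le_one_of_one_le_of_nonpos hP1 (by linarith)) hα1 hα2
    (rpow_pos_of_pos hP0 _) (h3 P hP0 hX)).trans ?_
  exact mul_le_mul_of_nonneg_left (rpow_le_rpow_of_exponent_le hX1 (by linarith)) hC.le
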